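/- arXiv:1912.04569 — 4 statements merged into one kernel-verified Lean document; each statement's English description precedes it below -/
import Mathlib

section
/- Let n ≤ 7 and let G be a simple graph on n vertices with minimum degree at least ⌊n/2⌋. If G has a spanning subgraph that is a 2T-graph, then G has property (*), unless G is the graph on seven vertices obtained by identifying two disjoint copies of the complete graph K₄ at a single vertex. -/
open SimpleGraph

universe u

variable {V : Type u}

/-- `T` is a spanning tree of `G`: a subgraph on the same vertex set which is
connected and acyclic. -/
def IsSpanningTree (G T : SimpleGraph V) : Prop :=
  T ≤ G ∧ T.Connected ∧ T.IsAcyclic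

/-- A 2T-graph: a graph on at least two vertices whose edge set is the disjoint
union of the edge sets of two edge-disjoint spanning trees. -/
def IsTwoT (G : SimpleGraph V) : Prop :=
  2 ≤ Nat.card V ∧
    ∃ I O : SimpleGraph V,
      IsSpanningTree G I ∧ IsSpanningTree G O ∧ I ⊓ O = ⊥ ∧ I ⊔ O = G

/-- An `(s,t)`-triple of `G`: a total (linear) order on the vertices together with two
edge-disjoint spanning trees `I` and `O` of `G` such that every vertex except `t` has a
larger neighbor in `I`, and every vertex except `s` has a smaller neighbor in `O`. -/
def HasSTTriple (G : SimpleGraph V) (s t : V) : Prop :=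
  ∃ (r : LinearOrder V) (I O : SimpleGraph V),
    IsSpanningTree G I ∧ IsSpanningTree G O ∧ I ⊓ O = ⊥ ∧
    (∀ v, v ≠ t → ∃ w, I.Adj v w ∧ r.lt v w) ∧
    (∀ v, v ≠ s → ∃ w, O.Adj v w ∧ r.lt w v)

/-- The degree of a vertex. -/
noncomputable def gdeg (G : SimpleGraph V) (v : V) : ℕ := (G.neighborSet v).ncard

/-- A quartic: a (simple) 2T-graph in which every vertex has degree 3 or 4. -/
def IsQuartic (G : SimpleGraph V) : Prop :=
  IsTwoT G ∧ ∀ v : V, gdeg G v = 3 ∨ gdeg G v = 4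

/-- A transit of a quartic: a vertex of degree 3. -/
def IsTransit (G : SimpleGraph V) (v : V) : Prop := gdeg G v = 3

/-- A quartic is excellent if it admits an `(s,t)`-triple for every pair of distinct
transits `s`, `t`. -/
def Excellent (G : SimpleGraph V) : Prop :=
  ∀ s t : V, IsTransit G s → IsTransit G t → s ≠ t → HasSTTriple G s t

/-- The edge neighborhood of a vertex set `S`: all edges of `G` with exactly one
endpoint in `S`. -/
def edgeNbhd (G : SimpleGraph V) (S : Set V) : Set (Sym2 V) :=
  {e | ∃ u v : V, e = s(u, v) ∧ G.Adj u v ∧ u ∈ S ∧ v ∉ S}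

/-- A set of edges is a matching if no two distinct edges share an endpoint. -/
def IsMatchingSet (M : Set (Sym2 V)) : Prop :=
  ∀ e ∈ M, ∀ f ∈ M, e ≠ f → ∀ v : V, v ∈ e → v ∉ f

/-- A quartic is normal if the edge neighborhood of every proper subquartic is a
matching of size 3 or 4. -/
def NormalQuartic (G : SimpleGraph V) : Prop :=
  ∀ H : G.Subgraph, IsQuartic H.coe → H ≠ ⊤ →
    IsMatchingSet (edgeNbhd G H.verts) ∧
      ((edgeNbhd G H.verts).ncard = 3 ∨ (edgeNbhd G H.verts).ncard = 4)

/-- A generic circuit: a 2T-graph with no proper subgraph which is a 2T-graph. -/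
def IsGenericCircuit (G : SimpleGraph V) : Prop :=
  IsTwoT G ∧ ∀ H : G.Subgraph, IsTwoT H.coe → H = ⊤

/-- Property (*): for every pair of distinct vertices `s, t` there is a spanning
subgraph which is a 2T-graph and admits an `(s,t)`-triple. -/
def PropertyStar (G : SimpleGraph V) : Prop :=
  ∀ s t : V, s ≠ t → ∃ H : SimpleGraph V, H ≤ G ∧ IsTwoT H ∧ HasSTTriple H s t

/-- `G` is obtained by identifying two disjoint copies of the complete graph `K_k`
at a single vertex. -/
def IsTwoCliquesAtVertex (G : SimpleGraph V) (k : ℕ) : Prop :=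
  ∃ (A B : Set V) (x : V), A ∩ B = {x} ∧ A ∪ B = Set.univ ∧ A.ncard = k ∧ B.ncard = k ∧
    ∀ u v : V, G.Adj u v ↔ u ≠ v ∧ ((u ∈ A ∧ v ∈ A) ∨ (u ∈ B ∧ v ∈ B))

section ParentTree

/-- The graph joining every vertex `v ≠ t` to its parent `p v`. -/
def parentGraph (t : V) (p : V → V) : SimpleGraph V :=
  SimpleGraph.fromRel fun v w => v ≠ t ∧ p v = w

theorem parentGraph_adj {t : V} {p : V → V} {v w : V} :
    (parentGraph t p).Adj v w ↔ v ≠ w ∧ ((v ≠ t ∧ p v = w) ∨ (w ≠ t ∧ p w = v)) :=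
  SimpleGraph.fromRel_adj _ _ _

theorem parentGraph_isTree [Finite V] {t : V} {p : V → V} (m : V → ℕ)
    (hm : ∀ v, v ≠ t → m (p v) < m v) : (parentGraph t p).IsTree := by
  have hreach : ∀ k v, m v = k → (parentGraph t p).Reachable v t := by
    intro k
    induction k using Nat.strong_induction_on with
    | _ k ih =>
      intro v hv
      by_cases hvt : v = t
      · exact hvt ▸ SimpleGraph.Reachable.refl v
      · have hlt := hm v hvt
        have hadj : (parentGraph t p).Adj v (p v) :=
          parentGraph_adj.2 ⟨fun h => by rw [← h] at hlt; omega, Or.inl ⟨hvt, rfl⟩⟩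
        exact hadj.reachable.trans (ih _ (hv ▸ hlt) _ rfl)
  have hconn : (parentGraph t p).Connected :=
    (SimpleGraph.connected_iff_exists_forall_reachable _).2
      ⟨t, fun v => (hreach _ v rfl).symm⟩
  refine SimpleGraph.isTree_iff_connected_and_card.2 ⟨hconn, ?_⟩
  have hsub : (parentGraph t p).edgeSet ⊆ (fun v => s(v, p v)) '' {t}ᶜ := by
    intro e
    induction e using Sym2.ind with
    | _ v w =>
      rw [SimpleGraph.mem_edgeSet, parentGraph_adj]
      rintro ⟨-, ⟨hv, rfl⟩ | ⟨hw, rfl⟩⟩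
      · exact ⟨v, hv, rfl⟩
      · exact ⟨w, hw, Sym2.eq_swap⟩
  have hle : (parentGraph t p).edgeSet.ncard ≤ ({t}ᶜ : Set V).ncard :=
    (Set.ncard_le_ncard hsub).trans (Set.ncard_image_le)
  have hcompl := Set.ncard_add_ncard_compl ({t} : Set V)
  rw [Set.ncard_singleton] at hcompl
  have hge := hconn.card_vert_le_card_edgeSet_add_one
  rw [Nat.card_coe_set_eq] at hge ⊢
  omega

/-- A ranking of the vertices together with a choice of a larger neighbor of each `v ≠ t` and a
smaller neighbor of each `v ≠ s`, using no edge twice, yields a spanning 2T-subgraph with an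
`(s,t)`-triple. -/
theorem exists_twoT_of_parents [Finite V] {G : SimpleGraph V} {s t : V} (hst : s ≠ t)
    (r : V → ℕ) (hr : Function.Injective r) (p q : V → V)
    (hp : ∀ v, v ≠ t → G.Adj v (p v) ∧ r v < r (p v))
    (hq : ∀ v, v ≠ s → G.Adj v (q v) ∧ r (q v) < r v)
    (hpq : ∀ v, v ≠ t → p v ≠ s → q (p v) ≠ v) :
    ∃ H : SimpleGraph V, H ≤ G ∧ IsTwoT H ∧ HasSTTriple H s t := by
  obtain ⟨N, hN⟩ := (Set.finite_range r).bddAbove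
  have hN' : ∀ v, r v ≤ N := fun v => hN ⟨v, rfl⟩
  have hI : (parentGraph t p).IsTree := parentGraph_isTree (fun v => N - r v) fun v hv => by
    have h1 := (hp v hv).2
    have h2 := hN' (p v)
    show N - r (p v) < N - r v
    omega
  have hO : (parentGraph s q).IsTree := parentGraph_isTree r fun v hv => (hq v hv).2
  have hIG : parentGraph t p ≤ G := by
    intro v w h
    obtain ⟨-, ⟨hv, rfl⟩ | ⟨hw, rfl⟩⟩ := parentGraph_adj.1 h
    exacts [(hp v hv).1, (hp w hw).1.symm]
  have hOG : parentGraph s q ≤ G := by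
    intro v w h
    obtain ⟨-, ⟨hv, rfl⟩ | ⟨hw, rfl⟩⟩ := parentGraph_adj.1 h
    exacts [(hq v hv).1, (hq w hw).1.symm]
  have hdisj : parentGraph t p ⊓ parentGraph s q = ⊥ := by
    ext v w
    rw [SimpleGraph.inf_adj, SimpleGraph.bot_adj, iff_false, parentGraph_adj, parentGraph_adj]
    rintro ⟨⟨-, ⟨hv, rfl⟩ | ⟨hw, rfl⟩⟩, -, ⟨hv', h⟩ | ⟨hw', h⟩⟩
    · have h1 := (hp v hv).2
      have h2 := (hq v hv').2
      rw [h] at h2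
      omega
    · exact hpq v hv hw' h
    · exact hpq w hw hv' h
    · have h1 := (hp w hw).2
      have h2 := (hq w hw').2
      rw [h] at h2
      omega
  have htI : IsSpanningTree (parentGraph t p ⊔ parentGraph s q) (parentGraph t p) :=
    ⟨le_sup_left, hI.1, hI.2⟩
  have htO : IsSpanningTree (parentGraph t p ⊔ parentGraph s q) (parentGraph s q) :=
    ⟨le_sup_right, hO.1, hO.2⟩
  have : Nontrivial V := ⟨s, t, hst⟩
  refine ⟨parentGraph t p ⊔ parentGraph s q, sup_le hIG hOG,
    ⟨Finite.one_lt_card, _, _, htI, htO, hdisj, rfl⟩,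
    LinearOrder.lift' r hr, _, _, htI, htO, hdisj, fun v hv => ⟨p v, ?_, ?_⟩,
    fun v hv => ⟨q v, ?_, ?_⟩⟩
  · exact parentGraph_adj.2 ⟨(hp v hv).1.ne, Or.inl ⟨hv, rfl⟩⟩
  · exact (hp v hv).2
  · exact parentGraph_adj.2 ⟨(hq v hv).1.ne, Or.inl ⟨hv, rfl⟩⟩
  · exact (hq v hv).2

theorem IsTwoT.two_mul_card_le_ncard_edgeSet [Finite V] {G H : SimpleGraph V} (hHG : H ≤ G)
    (hH : IsTwoT H) : 2 * Nat.card V ≤ G.edgeSet.ncard + 2 := by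
  obtain ⟨-, I, O, hI, hO, hdisj, -⟩ := hH
  have hIc := hI.2.1.card_vert_le_card_edgeSet_add_one
  have hOc := hO.2.1.card_vert_le_card_edgeSet_add_one
  rw [Nat.card_coe_set_eq] at hIc hOc
  have hd : Disjoint I.edgeSet O.edgeSet := by
    rw [SimpleGraph.disjoint_edgeSet, disjoint_iff, hdisj]
  have hsub : I.edgeSet ∪ O.edgeSet ⊆ G.edgeSet :=
    Set.union_subset (SimpleGraph.edgeSet_mono (hI.1.trans hHG))
      (SimpleGraph.edgeSet_mono (hO.1.trans hHG))
  have h1 := Set.ncard_le_ncard hsub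
  rw [Set.ncard_union_eq hd] at h1
  omega

end ParentTree

section Search

/-- `f x`, written so that the kernel evaluates `x` before substituting it. -/
def evalNat (x : ℕ) (f : ℕ → Bool) : Bool := Nat.rec (f 0) (fun k _ => f (Nat.succ k)) x

/-- `f l`, written so that the kernel evaluates the entries of `l` before substituting it. -/
def evalList (l : List ℕ) : (List ℕ → Bool) → Bool :=
  List.rec (fun f => f []) (fun a _ ih f => ih fun l' => evalNat a fun b => f (b :: l')) l

theorem evalNat_eq (x : ℕ) (f : ℕ → Bool) : evalNat x f = f x := by cases x <;> rfl

theorem evalList_eq (l : List ℕ) (f : List ℕ → Bool) : evalList l f = f l := by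
  induction l generalizing f with
  | nil => rfl
  | cons a l ih =>
    change evalList l (fun l' => evalNat a fun b => f (b :: l')) = _
    rw [ih, evalNat_eq]

/-- The set of natural numbers `l`, as a bit mask. -/
def bitSet (l : List ℕ) : ℕ := l.foldr (fun k m => Nat.lor (Nat.shiftLeft 1 k) m) 0

theorem testBit_one_shiftLeft (k j : ℕ) : (Nat.shiftLeft 1 k).testBit j = decide (k = j) := by
  change (1 <<< k).testBit j = _
  rw [Nat.one_shiftLeft, Nat.testBit_two_pow]

theorem testBit_lor (a b j : ℕ) : (Nat.lor a b).testBit j = (a.testBit j || b.testBit j) :=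
  Nat.testBit_or a b j

theorem testBit_land (a b j : ℕ) : (Nat.land a b).testBit j = (a.testBit j && b.testBit j) :=
  Nat.testBit_and a b j

theorem testBit_xor (a b j : ℕ) : (Nat.xor a b).testBit j = (a.testBit j ^^ b.testBit j) :=
  Nat.testBit_xor a b j

theorem testBit_bitSet {l : List ℕ} {k : ℕ} : (bitSet l).testBit k = true ↔ k ∈ l := by
  induction l with
  | nil => simp [bitSet]
  | cons a l ih =>
    change (Nat.lor (Nat.shiftLeft 1 a) (bitSet l)).testBit k = true ↔ _
    rw [testBit_lor, testBit_one_shiftLeft, Bool.or_eq_true, ih, decide_eq_true_iff,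
      List.mem_cons, eq_comm]

/-- Whether `x` has at most `k` bits equal to one. -/
def fewBits (k : ℕ) : ℕ → Bool :=
  Nat.rec (fun x => Nat.beq x 0)
    (fun _ ih x => Nat.beq x 0 || evalNat (Nat.xor x (Nat.shiftLeft 1 (Nat.log2 x))) ih) k

theorem card_le_of_fewBits {k x : ℕ} (h : fewBits k x = true) {S : Finset ℕ}
    (hS : ∀ j ∈ S, x.testBit j = true) : S.card ≤ k := by
  induction k generalizing x S with
  | zero =>
    obtain rfl : x = 0 := Nat.eq_of_beq_eq_true h
    rw [Finset.eq_empty_of_forall_notMem (s := S) fun j hj => by simpa using hS j hj]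
    rfl
  | succ k ih =>
    change (Nat.beq x 0 || evalNat (Nat.xor x (Nat.shiftLeft 1 (Nat.log2 x))) (fewBits k)) = true
      at h
    rw [evalNat_eq, Bool.or_eq_true] at h
    rcases h with h | h
    · obtain rfl : x = 0 := Nat.eq_of_beq_eq_true h
      rw [Finset.eq_empty_of_forall_notMem (s := S) fun j hj => by simpa using hS j hj]
      exact Nat.zero_le _
    · have := ih h (S := S.erase (Nat.log2 x)) fun j hj => by
        obtain ⟨hne, hj⟩ := Finset.mem_erase.1 hj
        rw [testBit_xor, testBit_one_shiftLeft, hS j hj, decide_eq_false (Ne.symm hne)]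
        rfl
      have := Finset.pred_card_le_card_erase (s := S) (a := Nat.log2 x)
      omega

/-- The entries of `L` sharing no bit with `b`. -/
def dropBit (b : ℕ) (L : List ℕ) : List ℕ :=
  List.rec [] (fun c _ ih => bif Nat.beq (Nat.land c b) 0 then c :: ih else ih) L

theorem dropBit_subset (b : ℕ) (L : List ℕ) : dropBit b L ⊆ L := by
  induction L with
  | nil => exact List.Subset.refl _
  | cons c L ih =>
    change (bif Nat.beq (Nat.land c b) 0 then c :: dropBit b L else dropBit b L) ⊆ _
    cases Nat.beq (Nat.land c b) 0
    · exact List.subset_cons_of_subset c ih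
    · exact List.cons_subset_cons c ih

/-- Search for a set of numbers between `P` and `M` which contains no entry of `L`, leaving out the
sets contained in a mask at which `prune` holds; the result is `true` if there is none. -/
def search (prune : ℕ → Bool) : ℕ → ℕ → ℕ → List ℕ → Bool
  | 0, _, _, _ => false
  | _ + 1, _, _, [] => false
  | f + 1, P, M, c :: L =>
    evalNat (Nat.xor c (Nat.land c P)) fun x => Nat.beq x 0 ||
      evalNat (Nat.shiftLeft 1 (Nat.log2 x)) fun b =>
        (evalNat (Nat.xor M b) fun M' => prune M' || search prune f P M' (dropBit b L)) &&
          evalNat (Nat.lor P b) fun P' => search prune f P' M (c :: L)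

theorem testBit_xor_of_notMem {A : Finset ℕ} {M k : ℕ} (hM : ∀ j ∈ A, M.testBit j = true)
    (hk : k ∉ A) : ∀ j ∈ A, (Nat.xor M (Nat.shiftLeft 1 k)).testBit j = true := by
  intro j hj
  have : k ≠ j := fun h => hk (h ▸ hj)
  rw [testBit_xor, testBit_one_shiftLeft, hM j hj, decide_eq_false this]
  rfl

theorem mem_of_testBit_lor {A : Finset ℕ} {P k : ℕ} (hP : ∀ j, P.testBit j = true → j ∈ A)
    (hk : k ∈ A) : ∀ j, (Nat.lor P (Nat.shiftLeft 1 k)).testBit j = true → j ∈ A := by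
  intro j hj
  rw [testBit_lor, testBit_one_shiftLeft, Bool.or_eq_true, decide_eq_true_iff] at hj
  rcases hj with hj | rfl
  exacts [hP j hj, hk]

theorem exists_subset_of_search {prune : ℕ → Bool} {A : Finset ℕ}
    (hprune : ∀ M, (∀ j ∈ A, M.testBit j = true) → prune M = false) {f P M : ℕ} {L : List ℕ}
    (h : search prune f P M L = true) (hP : ∀ j, P.testBit j = true → j ∈ A)
    (hM : ∀ j ∈ A, M.testBit j = true) :
    ∃ c ∈ L, ∀ j, c.testBit j = true → j ∈ A := by
  induction f generalizing P M L with
  | zero => simp [search] at h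
  | succ f ih =>
    cases L with
    | nil => simp [search] at h
    | cons c L =>
      simp only [search, evalNat_eq, Bool.or_eq_true, Bool.and_eq_true] at h
      rcases h with h | ⟨h₁, h₂⟩
      · refine ⟨c, List.mem_cons_self, fun j hj => hP j ?_⟩
        have hx := congrArg (fun x => Nat.testBit x j) (Nat.eq_of_beq_eq_true h)
        simpa [testBit_xor, testBit_land, hj] using hx
      · by_cases hk : Nat.log2 (Nat.xor c (Nat.land c P)) ∈ A
        · exact ih h₂ (mem_of_testBit_lor hP hk) hM
        · have hM' := testBit_xor_of_notMem hM hk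
          rcases h₁ with h₁ | h₁
          · rw [hprune _ hM'] at h₁
            contradiction
          · obtain ⟨d, hd, hdA⟩ := ih h₁ hP hM'
            exact ⟨d, List.mem_cons_of_mem _ (dropBit_subset _ _ hd), hdA⟩

/-- Check `leaf` after deciding for every entry of a list whether to put it into `P` or to remove
it from `M`. -/
def branch (leaf : ℕ → ℕ → Bool) : List ℕ → ℕ → ℕ → Bool
  | [], P, M => leaf P M
  | k :: ks, P, M =>
    branch leaf ks P (Nat.xor M (Nat.shiftLeft 1 k)) &&
      branch leaf ks (Nat.lor P (Nat.shiftLeft 1 k)) M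

theorem exists_of_branch {leaf : ℕ → ℕ → Bool} {ks : List ℕ} {A : Finset ℕ} {P M : ℕ}
    (h : branch leaf ks P M = true) (hP : ∀ j, P.testBit j = true → j ∈ A)
    (hM : ∀ j ∈ A, M.testBit j = true) :
    ∃ P' M', leaf P' M' = true ∧ (∀ j, P'.testBit j = true → j ∈ A) ∧
      ∀ j ∈ A, M'.testBit j = true := by
  induction ks generalizing P M with
  | nil => exact ⟨P, M, h, hP, hM⟩
  | cons k ks ih =>
    simp only [branch, Bool.and_eq_true] at h
    by_cases hk : k ∈ A
    · exact ih h.2 (mem_of_testBit_lor hP hk) hM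
    · exact ih h.1 hP (testBit_xor_of_notMem hM hk)

end Search

section Encoding

/-- The code of the pair `{i, j}`: eight times the smaller label plus the larger one. -/
def pairCode (i j : ℕ) : ℕ := bif Nat.blt i j then 8 * i + j else 8 * j + i

/-- Whether `k` is the code of a pair of distinct labels less than `n`. -/
def IsPairCode (n k : ℕ) : Bool := Nat.blt (k / 8) (k % 8) && Nat.blt (k % 8) n

/-- The codes of all pairs of distinct labels less than `n`. -/
def pairCodes (n : ℕ) : List ℕ := (List.range (8 * n)).filter (IsPairCode n)

theorem blt_iff {a b : ℕ} : Nat.blt a b = true ↔ a < b :=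
  ⟨Nat.le_of_ble_eq_true, Nat.ble_eq_true_of_le⟩

theorem mem_pairCodes {n k : ℕ} : k ∈ pairCodes n ↔ k / 8 < k % 8 ∧ k % 8 < n := by
  simp only [pairCodes, IsPairCode, List.mem_filter, List.mem_range, Bool.and_eq_true, blt_iff]
  omega

theorem pairCode_of_lt {i j : ℕ} (h : i < j) : pairCode i j = 8 * i + j := by
  rw [pairCode, blt_iff.2 h, cond_true]

theorem pairCode_of_gt {i j : ℕ} (h : j < i) : pairCode i j = 8 * j + i := by
  have : Nat.blt i j = false := Bool.eq_false_iff.2 fun h' => by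
    have := blt_iff.1 h'
    omega
  rw [pairCode, this, cond_false]

/-- `f` lists the elements of `V` as `f 0, …, f (n - 1)`, without repetition. -/
structure IsLabelling (n : ℕ) (f : ℕ → V) : Prop where
  injOn : ∀ i < n, ∀ j < n, f i = f j → i = j
  surj : ∀ v, ∃ i < n, f i = v

open Classical in
/-- The codes of the edges of `G` with respect to a labelling `f`. -/
noncomputable def edgeCodes (n : ℕ) (f : ℕ → V) (G : SimpleGraph V) : Finset ℕ :=
  (pairCodes n).toFinset.filter fun k => G.Adj (f (k / 8)) (f (k % 8))

variable {n : ℕ} {f : ℕ → V} {G : SimpleGraph V}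

theorem mem_edgeCodes {k : ℕ} :
    k ∈ edgeCodes n f G ↔ k ∈ pairCodes n ∧ G.Adj (f (k / 8)) (f (k % 8)) := by
  simp only [edgeCodes, Finset.mem_filter, List.mem_toFinset]

theorem pairCode_mem_edgeCodes (hn : n ≤ 8) {i j : ℕ} (hi : i < n) (hj : j < n) :
    pairCode i j ∈ edgeCodes n f G ↔ G.Adj (f i) (f j) := by
  rw [mem_edgeCodes, mem_pairCodes]
  rcases lt_trichotomy i j with h | rfl | h
  · rw [pairCode_of_lt h, show (8 * i + j) / 8 = i by omega, show (8 * i + j) % 8 = j by omega]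
    tauto
  · have h1 : pairCode i i = 8 * i + i := by rw [pairCode, Bool.cond_self]
    rw [h1, show (8 * i + i) / 8 = i by omega, show (8 * i + i) % 8 = i by omega]
    simp
  · rw [pairCode_of_gt h, show (8 * j + i) / 8 = j by omega, show (8 * j + i) % 8 = i by omega,
      G.adj_comm]
    tauto

theorem mem_edgeCodes_of_lt (hn : n ≤ 8) {i j : ℕ} (hij : i < j) (hj : j < n) :
    8 * i + j ∈ edgeCodes n f G ↔ G.Adj (f i) (f j) := by
  rw [← pairCode_of_lt hij, pairCode_mem_edgeCodes hn (hij.trans hj) hj]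

theorem ncard_edgeSet_le (hn : n ≤ 8) (hf : IsLabelling n f) :
    G.edgeSet.ncard ≤ (edgeCodes n f G).card := by
  have hsub : G.edgeSet ⊆ (fun k => s(f (k / 8), f (k % 8))) '' (edgeCodes n f G : Set ℕ) := by
    intro e
    induction e using Sym2.ind with
    | _ u v =>
      intro h
      obtain ⟨i, hi, rfl⟩ := hf.surj u
      obtain ⟨j, hj, rfl⟩ := hf.surj v
      rw [SimpleGraph.mem_edgeSet] at h
      have hmem := (pairCode_mem_edgeCodes hn hi hj).2 h
      refine ⟨pairCode i j, hmem, ?_⟩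
      rcases lt_trichotomy i j with hij | rfl | hij
      · simp only [pairCode_of_lt hij, show (8 * i + j) / 8 = i by omega,
          show (8 * i + j) % 8 = j by omega]
      · exact absurd h (G.loopless.irrefl _)
      · simp only [pairCode_of_gt hij, show (8 * j + i) / 8 = j by omega,
          show (8 * j + i) % 8 = i by omega]
        exact Sym2.eq_swap
  have hfin : ((edgeCodes n f G : Finset ℕ) : Set ℕ).Finite := Finset.finite_toSet _
  calc G.edgeSet.ncard ≤ _ := Set.ncard_le_ncard hsub (hfin.image _)
    _ ≤ (edgeCodes n f G : Set ℕ).ncard := Set.ncard_image_le hfin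
    _ = _ := Set.ncard_coe_finset _

/-- The mask of the codes of all pairs containing the label `i`. -/
def starMask (n i : ℕ) : ℕ := bitSet ((pairCodes n).filter fun k => k / 8 == i || k % 8 == i)

theorem gdeg_le (hn : n ≤ 8) (hf : IsLabelling n f) {i : ℕ} (hi : i < n) :
    gdeg G (f i) ≤ ((edgeCodes n f G).filter fun k => (starMask n i).testBit k = true).card := by
  set S := (edgeCodes n f G).filter fun k => (starMask n i).testBit k = true with hS
  have hsub : G.neighborSet (f i) ⊆
      (fun k => if k / 8 = i then f (k % 8) else f (k / 8)) '' (S : Set ℕ) := by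
    intro v h
    obtain ⟨j, hj, rfl⟩ := hf.surj v
    rw [SimpleGraph.mem_neighborSet] at h
    have hmem := (pairCode_mem_edgeCodes hn hi hj).2 h
    have hstar : pairCode i j / 8 = i ∧ pairCode i j % 8 = j ∨
        pairCode i j / 8 = j ∧ pairCode i j % 8 = i ∧ i ≠ j := by
      rcases lt_trichotomy i j with hij | rfl | hij
      · rw [pairCode_of_lt hij]
        omega
      · exact absurd h (G.loopless.irrefl _)
      · rw [pairCode_of_gt hij]
        omega
    refine ⟨pairCode i j, ?_, ?_⟩
    · rw [Finset.mem_coe, hS, Finset.mem_filter, starMask, testBit_bitSet, List.mem_filter]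
      refine ⟨hmem, (mem_edgeCodes.1 hmem).1, ?_⟩
      rcases hstar with h' | h' <;> simp [h']
    · rcases hstar with ⟨h1, h2⟩ | ⟨h1, h2, h3⟩
      · simp [h1, h2]
      · simp [h1, h3.symm]
  calc gdeg G (f i) ≤ _ := Set.ncard_le_ncard hsub ((Finset.finite_toSet S).image _)
    _ ≤ (S : Set ℕ).ncard := Set.ncard_image_le (Finset.finite_toSet S)
    _ = _ := Set.ncard_coe_finset _

end Encoding

section TripleCodes

/-- The `i`-th octal digit of `c`. -/
def octDigit (c i : ℕ) : ℕ := Nat.mod (Nat.shiftRight c (Nat.mul 3 i)) 8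

/-- The rank of the label `v` in the order encoded by `c`. -/
def rankDigit (c v : ℕ) : ℕ := octDigit c (Nat.mul 3 v)

/-- The larger neighbor of the label `v` encoded by `c`. -/
def upDigit (c v : ℕ) : ℕ := octDigit c (Nat.add (Nat.mul 3 v) 1)

/-- The smaller neighbor of the label `v` encoded by `c`. -/
def downDigit (c v : ℕ) : ℕ := octDigit c (Nat.add (Nat.mul 3 v) 2)

/-- The codes of the edges joining the labels to their larger and smaller neighbors. -/
def tripleEdges (n c : ℕ) : List ℕ :=
  (List.range (n - 1)).map (fun v => pairCode v (upDigit c v)) ++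
    (List.range (n - 1)).map fun v => pairCode (v + 1) (downDigit c (v + 1))

/-- Whether `c` encodes a `(0, n - 1)`-triple on the labels less than `n`. -/
def IsTripleCode (n c : ℕ) : Bool :=
  (List.range n).all fun v =>
    (Nat.beq v (n - 1) ||
      (Nat.blt (upDigit c v) n && Nat.blt (rankDigit c v) (rankDigit c (upDigit c v)) &&
        !(Nat.beq (downDigit c (upDigit c v)) v))) &&
    (Nat.beq v 0 ||
      (Nat.blt (downDigit c v) n && Nat.blt (rankDigit c (downDigit c v)) (rankDigit c v))) &&
    (List.range n).all fun w => Nat.beq v w || !(Nat.beq (rankDigit c v) (rankDigit c w))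

theorem exists_twoT_of_isTripleCode [Finite V] {G : SimpleGraph V} {n c : ℕ} {f : ℕ → V}
    (hn : n ≤ 8) (hn2 : 2 ≤ n) (hf : IsLabelling n f) (hc : IsTripleCode n c = true)
    (hG : ∀ k ∈ tripleEdges n c, k ∈ edgeCodes n f G) :
    ∃ H : SimpleGraph V, H ≤ G ∧ IsTwoT H ∧ HasSTTriple H (f 0) (f (n - 1)) := by
  choose g hgn hg using hf.surj
  have hgf : ∀ i < n, g (f i) = i := fun i hi => hf.injOn _ (hgn _) _ hi (hg _)
  simp only [IsTripleCode, List.all_eq_true, List.mem_range, Bool.and_eq_true, Bool.or_eq_true,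
    Nat.beq_eq, blt_iff, Bool.not_eq_true', Bool.eq_false_iff, ne_eq] at hc
  have hup : ∀ v < n - 1, G.Adj (f v) (f (upDigit c v)) := fun v hv => by
    have h := (hc v (by omega)).1.1.resolve_left (by omega)
    refine (pairCode_mem_edgeCodes hn (by omega) h.1.1).1 (hG _ ?_)
    exact List.mem_append_left _ (List.mem_map.2 ⟨v, List.mem_range.2 hv, rfl⟩)
  have hdown : ∀ v < n, v ≠ 0 → G.Adj (f v) (f (downDigit c v)) := fun v hv hv0 => by
    have h := (hc v hv).1.2.resolve_left hv0
    refine (pairCode_mem_edgeCodes hn hv h.1).1 (hG _ ?_)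
    refine List.mem_append_right _ (List.mem_map.2 ⟨v - 1, List.mem_range.2 (by omega), ?_⟩)
    simp only [Nat.sub_add_cancel (Nat.one_le_iff_ne_zero.2 hv0)]
  have hlast : ∀ v, v ≠ f (n - 1) → g v ≠ n - 1 := fun v hv h => hv (by rw [← h, hg])
  have hzero : ∀ v, v ≠ f 0 → g v ≠ 0 := fun v hv h => hv (by rw [← h, hg])
  refine exists_twoT_of_parents (fun h => ?_) (fun v => rankDigit c (g v)) (fun u v h => ?_)
    (fun v => f (upDigit c (g v))) (fun v => f (downDigit c (g v))) (fun v hv => ?_)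
    (fun v hv => ?_) fun v hv hs h => ?_
  · have := hf.injOn 0 (by omega) (n - 1) (by omega) h
    omega
  · have := ((hc _ (hgn u)).2 _ (hgn v)).resolve_right fun h' => h' h
    rw [← hg u, ← hg v, this]
  · have h := (hc _ (hgn v)).1.1.resolve_left (hlast v hv)
    have hadj := hup (g v) (by have := hgn v; have := hlast v hv; omega)
    rw [hg] at hadj
    exact ⟨hadj, by simpa only [hgf _ h.1.1] using h.1.2⟩
  · have h := (hc _ (hgn v)).1.2.resolve_left (hzero v hv)
    have hadj := hdown (g v) (hgn v) (hzero v hv)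
    rw [hg] at hadj
    exact ⟨hadj, by simpa only [hgf _ h.1] using h.2⟩
  · have h' := (hc _ (hgn v)).1.1.resolve_left (hlast v hv)
    have hd := (hc _ h'.1.1).1.2.resolve_left fun h0 => hs (by rw [h0])
    simp only [hgf _ h'.1.1] at h
    exact h'.2 (by rw [← hgf _ hd.1, h])

end TripleCodes

section TwoCliques

/-- The edge codes of the graph on the labels less than seven whose blocks are the cliques on `a`
and on `x` together with the complement of `a`. -/
def cliqueMask (a x : ℕ) : ℕ :=
  bitSet ((pairCodes 7).filter fun k =>
    (a.testBit (k / 8) && a.testBit (k % 8)) ||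
      ((127 ^^^ a ||| 1 <<< x).testBit (k / 8) && (127 ^^^ a ||| 1 <<< x).testBit (k % 8)))

/-- The masks of all graphs obtained by identifying two disjoint copies of `K₄` at a vertex. -/
def cliqueMasks (n : ℕ) : List ℕ :=
  if n = 7 then
    (List.range 128).flatMap fun a =>
      if (List.range 7).countP a.testBit = 4 then
        ((List.range 7).filter a.testBit).map (cliqueMask a)
      else []
  else []

theorem mem_cliqueMasks {n M : ℕ} (h : M ∈ cliqueMasks n) :
    n = 7 ∧ ∃ a x, (List.range 7).countP a.testBit = 4 ∧ x < 7 ∧ a.testBit x = true ∧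
      M = cliqueMask a x := by
  unfold cliqueMasks at h
  split_ifs at h with hn
  · obtain ⟨a, -, h⟩ := List.mem_flatMap.1 h
    split_ifs at h with ha
    · obtain ⟨x, hx, rfl⟩ := List.mem_map.1 h
      rw [List.mem_filter, List.mem_range] at hx
      exact ⟨hn, a, x, ha, hx.1, hx.2, rfl⟩
    · exact absurd h List.not_mem_nil
  · exact absurd h List.not_mem_nil

theorem isTwoCliquesAtVertex_of_edgeCodes [Fintype V] {G : SimpleGraph V} {f : ℕ → V}
    (hf : IsLabelling 7 f) (hV : Fintype.card V = 7) {a x : ℕ}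
    (ha : (List.range 7).countP a.testBit = 4) (hx : x < 7) (hax : a.testBit x = true)
    (hG : ∀ k, k ∈ edgeCodes 7 f G ↔ (cliqueMask a x).testBit k = true) :
    IsTwoCliquesAtVertex G 4 := by
  have hb : ∀ i < 7, (127 ^^^ a ||| 1 <<< x).testBit i = true ↔ a.testBit i = false ∨ i = x := by
    intro i hi
    rw [Nat.testBit_or, Nat.testBit_xor, show 127 = 2 ^ 7 - 1 from rfl,
      Nat.testBit_two_pow_sub_one, Nat.one_shiftLeft, Nat.testBit_two_pow]
    cases a.testBit i <;> simp [hi, eq_comm]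
  generalize hbdef : (127 ^^^ a ||| 1 <<< x) = b at hb
  let A : Set V := {v | ∃ i < 7, a.testBit i = true ∧ f i = v}
  let B : Set V := {v | ∃ i < 7, b.testBit i = true ∧ f i = v}
  have hmem : ∀ c : ℕ, ∀ i < 7, (∃ j < 7, c.testBit j = true ∧ f j = f i) ↔ c.testBit i = true :=
    fun c i hi => ⟨fun ⟨j, hj, hc, h⟩ => hf.injOn j hj i hi h ▸ hc, fun h => ⟨i, hi, h, rfl⟩⟩
  have hinter : A ∩ B = {f x} := by
    ext v
    obtain ⟨i, hi, rfl⟩ := hf.surj v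
    have hiff : f i = f x ↔ i = x := ⟨hf.injOn i hi x hx, fun h => h ▸ rfl⟩
    simp only [A, B, Set.mem_inter_iff, Set.mem_ofPred_eq, Set.mem_singleton_iff, hmem _ i hi,
      hb i hi, hiff]
    constructor
    · rintro ⟨h1, h2 | h2⟩
      · rw [h1] at h2
        contradiction
      · exact h2
    · rintro rfl
      exact ⟨hax, Or.inr rfl⟩
  have hunion : A ∪ B = Set.univ := by
    ext v
    obtain ⟨i, hi, rfl⟩ := hf.surj v
    simp only [A, B, Set.mem_union, Set.mem_ofPred_eq, Set.mem_univ, iff_true, hmem _ i hi, hb i hi]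
    cases a.testBit i <;> simp
  have hA : A.ncard = 4 := by
    have himage : A = f '' (((Finset.range 7).filter fun i => a.testBit i = true : Finset ℕ)) := by
      ext v
      simp [A, and_assoc]
    rw [himage, Set.InjOn.ncard_image, Set.ncard_coe_finset, ← ha, List.countP_eq_length_filter]
    · change (List.filter (fun i => decide (a.testBit i = true)) (List.range 7)).length = _
      simp only [Bool.decide_eq_true]
    · intro i hi j hj h
      simp only [Finset.coe_filter, Finset.mem_range, Set.mem_ofPred_eq] at hi hj
      exact hf.injOn i hi.1 j hj.1 h
  have hB : B.ncard = 4 := by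
    have h := Set.ncard_union_add_ncard_inter A B
    rw [hunion, hinter, Set.ncard_univ, Nat.card_eq_fintype_card, hV, Set.ncard_singleton, hA] at h
    omega
  refine ⟨A, B, f x, hinter, hunion, hA, hB, fun u v => ?_⟩
  obtain ⟨i, hi, rfl⟩ := hf.surj u
  obtain ⟨j, hj, rfl⟩ := hf.surj v
  have hiff : f i = f j ↔ i = j := ⟨hf.injOn i hi j hj, fun h => h ▸ rfl⟩
  rw [← pairCode_mem_edgeCodes (n := 7) (by norm_num) hi hj, hG, cliqueMask, testBit_bitSet,
    List.mem_filter, mem_pairCodes, hbdef]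
  simp only [A, B, Set.mem_ofPred_eq, hmem _ i hi, hmem _ j hj, Bool.or_eq_true, Bool.and_eq_true,
    ne_eq, hiff]
  rcases lt_trichotomy i j with h | rfl | h
  · rw [pairCode_of_lt h, show (8 * i + j) / 8 = i by omega, show (8 * i + j) % 8 = j by omega]
    simp only [h, hj, h.ne, not_false_eq_true, true_and]
  · rw [show pairCode i i = 8 * i + i by rw [pairCode, Bool.cond_self],
      show (8 * i + i) / 8 = i by omega, show (8 * i + i) % 8 = i by omega]
    simp
  · rw [pairCode_of_gt h, show (8 * j + i) / 8 = j by omega, show (8 * j + i) % 8 = i by omega]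
    simp only [h, hi, h.ne', not_false_eq_true, true_and]
    tauto

/-- Whether every graph on `n` labels with edge codes in `M` has a vertex of degree less than
`n / 2`, or fewer than `2 * (n - 1)` edges, or consists of two copies of `K₄` sharing a vertex. -/
def violates (n : ℕ) (stars cliques : List ℕ) (M : ℕ) : Bool :=
  stars.any (fun s => evalNat (Nat.land s M) (fewBits (Nat.pred (Nat.div n 2)))) ||
    fewBits (Nat.sub (Nat.mul 2 n) 3) M ||
    (fewBits (Nat.sub (Nat.mul 2 n) 2) M && cliques.any (Nat.beq M))

theorem isTwoCliquesAtVertex_of_violates [Fintype V] {G : SimpleGraph V} {n : ℕ} {f : ℕ → V}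
    (hn : n ≤ 8) (hn2 : 2 ≤ n) (hV : Fintype.card V = n) (hf : IsLabelling n f)
    (hdeg : ∀ v, n / 2 ≤ gdeg G v) (hedge : 2 * n ≤ G.edgeSet.ncard + 2) {M : ℕ}
    (h : violates n ((List.range n).map (starMask n)) (cliqueMasks n) M = true)
    (hM : ∀ j ∈ edgeCodes n f G, M.testBit j = true) :
    Fintype.card V = 7 ∧ IsTwoCliquesAtVertex G 4 := by
  have hcard := hedge.trans (Nat.add_le_add_right (ncard_edgeSet_le hn hf) 2)
  rw [violates, Bool.or_eq_true, Bool.or_eq_true] at h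
  rcases h with (h | h) | h
  · obtain ⟨s, hs, h⟩ := List.any_eq_true.1 h
    obtain ⟨i, hi, rfl⟩ := List.mem_map.1 hs
    rw [evalNat_eq] at h
    have h1 := card_le_of_fewBits h
      (S := (edgeCodes n f G).filter fun k => (starMask n i).testBit k = true) fun j hj => by
        rw [Finset.mem_filter] at hj
        rw [testBit_land, hj.2, hM j hj.1]
        rfl
    have h2 := gdeg_le (G := G) hn hf (List.mem_range.1 hi)
    have h3 := hdeg (f i)
    change _ ≤ n / 2 - 1 at h1
    omega
  · have h1 := card_le_of_fewBits h hM
    change _ ≤ 2 * n - 3 at h1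
    omega
  · rw [Bool.and_eq_true] at h
    obtain ⟨hfew, h⟩ := h
    obtain ⟨M', hM', h⟩ := List.any_eq_true.1 h
    obtain rfl : M = M' := Nat.eq_of_beq_eq_true h
    obtain ⟨rfl, a, x, ha, hx, hax, rfl⟩ := mem_cliqueMasks hM'
    refine ⟨hV, isTwoCliquesAtVertex_of_edgeCodes hf hV ha hx hax fun k => ⟨hM k, fun hk => ?_⟩⟩
    by_contra hkn
    have h1 := card_le_of_fewBits hfew (S := insert k (edgeCodes 7 f G)) fun j hj => by
      rcases Finset.mem_insert.1 hj with rfl | hj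
      exacts [hk, hM j hj]
    rw [Finset.card_insert_of_notMem hkn] at h1
    change _ ≤ 12 at h1
    omega

end TwoCliques

section SortedLabelling

/-- Whether the labels between `0` and `n - 1` are not sorted by their adjacencies to `0` and
`n - 1` in any graph whose set of edge codes lies between `P` and `M`. -/
def unsorted (n P M : ℕ) : Bool :=
  (List.range (n - 3)).any fun i =>
    (P.testBit (i + 1) && !M.testBit (i + 2)) ||
    (P.testBit (8 * (i + 1) + (n - 1)) && !M.testBit (8 * (i + 2) + (n - 1)) &&
      (P.testBit (i + 1) || !M.testBit (i + 2)))

open Classical in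
/-- The number by which the vertices other than `s` and `t` are sorted. -/
noncomputable def endKey (G : SimpleGraph V) (s t v : V) : ℕ :=
  (if G.Adj s v then 2 else 0) + if G.Adj v t then 1 else 0

open Classical in
theorem exists_sorted_labelling [Fintype V] (G : SimpleGraph V) {s t : V} (hst : s ≠ t) {n : ℕ}
    (hV : Fintype.card V = n) :
    ∃ f : ℕ → V, IsLabelling n f ∧ f 0 = s ∧ f (n - 1) = t ∧
      ∀ i, i + 3 < n → endKey G s t (f (i + 1)) ≤ endKey G s t (f (i + 2)) := by
  let e := (Fintype.equivFinOfCardEq hV).symm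
  let key : V → ℕ := fun v => if v = s then 0 else if v = t then 5 else endKey G s t v + 1
  have hle : ∀ v, endKey G s t v ≤ 3 := fun v => by
    unfold endKey
    split_ifs <;> omega
  have hkey0 : ∀ v, key v = 0 → v = s := fun v h => by
    by_contra hv
    simp only [key, if_neg hv] at h
    split_ifs at h
  have hkey5 : ∀ v, 5 ≤ key v → v = t := fun v h => by
    by_contra hv
    have := hle v
    simp only [key, if_neg hv] at h
    split_ifs at h <;> omega
  have hkey5' : ∀ v, key v ≤ 5 := fun v => by
    have := hle v
    simp only [key]
    split_ifs <;> omega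
  let σ := (Tuple.sort (key ∘ e)).trans e
  have hmono : Monotone (key ∘ σ) := Tuple.monotone_sort (key ∘ e)
  have hf : ∀ i (hi : i < n), (fun i => if h : i < n then σ ⟨i, h⟩ else s) i = σ ⟨i, hi⟩ :=
    fun i hi => dif_pos hi
  generalize (fun i => if h : i < n then σ ⟨i, h⟩ else s) = f at hf
  have hlab : IsLabelling n f := by
    refine ⟨fun i hi j hj h => ?_, fun v => ⟨σ.symm v, (σ.symm v).2, ?_⟩⟩
    · rw [hf i hi, hf j hj] at h
      exact Fin.mk.inj_iff.1 (σ.injective h)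
    · rw [hf _ (σ.symm v).2]
      exact σ.apply_symm_apply v
  have hsorted : ∀ i j, i ≤ j → j < n → key (f i) ≤ key (f j) := fun i j hij hj => by
    rw [hf i (by omega), hf j hj]
    exact hmono (Fin.mk_le_mk.2 hij)
  obtain ⟨i, hi, hsi⟩ := hlab.surj s
  obtain ⟨j, hj, htj⟩ := hlab.surj t
  have h0 : f 0 = s := hkey0 _ (by
    have := hsorted 0 i (Nat.zero_le _) hi
    rw [hsi] at this
    simpa [key] using this)
  have h1 : f (n - 1) = t := hkey5 _ (by
    have := hsorted j (n - 1) (by omega) (by omega)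
    rw [htj] at this
    simpa [key, hst.symm] using this)
  refine ⟨f, hlab, h0, h1, fun i hi => ?_⟩
  have hne : ∀ k, k ≠ 0 → k + 1 < n → key (f k) = endKey G s t (f k) + 1 := fun k hk0 hk => by
    have hks : f k ≠ s := fun h => hk0 (hlab.injOn k (by omega) 0 (by omega) (by rw [h, h0]))
    have hkt : f k ≠ t := fun h => by
      have := hlab.injOn k (by omega) (n - 1) (by omega) (by rw [h, h1])
      omega
    simp only [key, if_neg hks, if_neg hkt]
  have := hsorted (i + 1) (i + 2) (by omega) (by omega)
  rw [hne _ (by omega) (by omega), hne _ (by omega) (by omega)] at this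
  omega

theorem unsorted_eq_false {G : SimpleGraph V} {n P M : ℕ} {f : ℕ → V} (hn : n ≤ 8)
    (hf : ∀ i, i + 3 < n →
      endKey G (f 0) (f (n - 1)) (f (i + 1)) ≤ endKey G (f 0) (f (n - 1)) (f (i + 2)))
    (hP : ∀ j, P.testBit j = true → j ∈ edgeCodes n f G)
    (hM : ∀ j ∈ edgeCodes n f G, M.testBit j = true) : unsorted n P M = false := by
  refine Bool.eq_false_iff.2 fun h => ?_
  obtain ⟨i, hi, h⟩ := List.any_eq_true.1 h
  rw [List.mem_range] at hi
  have hle := hf i (by omega)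
  have hs : ∀ j, 0 < j → j < n → (j ∈ edgeCodes n f G ↔ G.Adj (f 0) (f j)) := fun j hj hjn => by
    rw [← mem_edgeCodes_of_lt hn hj hjn, Nat.mul_zero, Nat.zero_add]
  have ht : ∀ j, j < n - 1 → (8 * j + (n - 1) ∈ edgeCodes n f G ↔ G.Adj (f j) (f (n - 1))) :=
    fun j hj => mem_edgeCodes_of_lt hn hj (by omega)
  have hM' : ∀ j, M.testBit j = false → j ∉ edgeCodes n f G := fun j h hj => by
    rw [hM j hj] at h
    contradiction
  simp only [Bool.or_eq_true, Bool.and_eq_true, Bool.not_eq_true'] at h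
  have hs1 := hs (i + 1) (by omega) (by omega)
  have hs2 := hs (i + 2) (by omega) (by omega)
  have ht1 := ht (i + 1) (by omega)
  have ht2 := ht (i + 2) (by omega)
  unfold endKey at hle
  rcases h with ⟨h1, h2⟩ | ⟨⟨h1, h2⟩, h3⟩
  · have h1 := hs1.1 (hP _ h1)
    have h2 := mt hs2.2 (hM' _ h2)
    rw [if_pos h1, if_neg h2] at hle
    split_ifs at hle <;> omega
  · have h1 := ht1.1 (hP _ h1)
    have h2 := mt ht2.2 (hM' _ h2)
    rw [if_pos h1, if_neg h2] at hle
    rcases h3 with h3 | h3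
    · rw [if_pos (hs1.1 (hP _ h3))] at hle
      split_ifs at hle <;> omega
    · rw [if_neg (mt hs2.2 (hM' _ h3))] at hle
      split_ifs at hle <;> omega

end SortedLabelling

section Covers

/-- The codes of the pairs `{0, i}` and `{i, n - 1}` with `0 < i < n - 1`. -/
def endCodes (n : ℕ) : List ℕ :=
  (List.range (n - 2)).flatMap fun i => [i + 1, 8 * (i + 1) + (n - 1)]

/-- Check that the edge codes of every sorted labelled graph on `n` vertices which satisfies the
assumptions of the theorem and is not exceptional contain an entry of `L`. -/
def covers (n : ℕ) (L : List ℕ) : Bool :=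
  evalList L fun L =>
    evalList ((List.range n).map (starMask n)) fun stars =>
      evalList (cliqueMasks n) fun cliques =>
        branch (fun P M => unsorted n P M || evalNat P fun P => evalNat M fun M =>
          violates n stars cliques M ||
            search (violates n stars cliques) 22 P M (L.filter fun c => Nat.beq (Nat.land c M) c))
          (endCodes n) 0 (bitSet (pairCodes n))

theorem propertyStar_or_of_covers [Fintype V] {G : SimpleGraph V} {n : ℕ} {C : List ℕ} (hn : n ≤ 8)
    (hV : Fintype.card V = n) (hdeg : ∀ v, n / 2 ≤ gdeg G v)
    (hedge : 2 * n ≤ G.edgeSet.ncard + 2) (hC : C.all (IsTripleCode n) = true)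
    (hcov : covers n (C.map fun c => bitSet (tripleEdges n c)) = true) :
    PropertyStar G ∨ (Fintype.card V = 7 ∧ IsTwoCliquesAtVertex G 4) := by
  refine or_iff_not_imp_right.2 fun hexc s t hst => ?_
  have : Nontrivial V := ⟨s, t, hst⟩
  have hn2 : 2 ≤ n := hV ▸ Fintype.one_lt_card
  obtain ⟨f, hf, rfl, rfl, hsorted⟩ := exists_sorted_labelling G hst hV
  have hviol : ∀ M, (∀ j ∈ edgeCodes n f G, M.testBit j = true) →
      violates n ((List.range n).map (starMask n)) (cliqueMasks n) M = false := fun M hM =>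
    Bool.eq_false_iff.2 fun h =>
      hexc (isTwoCliquesAtVertex_of_violates hn hn2 hV hf hdeg hedge h hM)
  simp only [covers, evalList_eq, evalNat_eq] at hcov
  obtain ⟨P, M, h, hP, hM⟩ := exists_of_branch (A := edgeCodes n f G) hcov (by simp)
    fun j hj => testBit_bitSet.2 (mem_edgeCodes.1 hj).1
  rw [unsorted_eq_false hn hsorted hP hM, hviol M hM, Bool.false_or, Bool.false_or] at h
  obtain ⟨c, hc, hcG⟩ := exists_subset_of_search hviol h hP hM
  obtain ⟨d, hd, rfl⟩ := List.mem_map.1 (List.mem_of_mem_filter hc)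
  exact exists_twoT_of_isTripleCode hn hn2 hf (List.all_eq_true.1 hC d hd)
    fun k hk => hcG k (testBit_bitSet.2 hk)

end Covers

section Tables

/-- Codes of `(0, 3)`-triples on four labels. -/
def tripleCodes4 : List ℕ := [
  7942452176]

/-- Codes of `(0, 4)`-triples on five labels. -/
def tripleCodes5 : List ℕ := [
  4145054823896, 4136464893400, 4144920610776, 4127657150416, 12941007374296, 17319615907296,
  4144914352088, 4127889830864, 4127891928016, 4145055015896, 4127791526864, 12923965879752,
  4127891932112, 4136331133912, 8525938439120, 4144920545240, 12923965883848, 17319599130056]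

/-- Codes of `(0, 5)`-triples on six labels. -/
def tripleCodes6 : List ℕ := [
  2149104271644632, 2153673963447776, 2149284726523352, 6652892801255384, 8917727715665888,
  6657136502002656, 6652884218041304, 8904674520880080, 8904605558233552, 2153673965262816,
  2149207564108752, 8904619606825432, 8904605558266320, 11155169722115528, 6652807176598984,
  2157998997330400, 2162328324941792, 2162328341719008, 2158071978513888, 2157934916548576,
  11155169780292048, 8904672088540616, 2162332569544672, 6661534543919072, 2149276149363664,
  11154070277052880, 8904619606759896, 2160130391890400, 2160679057512416, 2153602041894368,
  2149293173884888, 11155169780324816, 11162935017953760, 2162329365108704, 4401084540208600,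
  6652875759764936, 2149220165769688, 2149168760314328, 11154620100261320, 8904602345429456,
  2149276151460816, 8904605516801480, 2162332569458656, 2149293180078040, 2149207566205904,
  2153605246330336, 2149078636045784, 2162329365141472, 2147450692131288, 2149104204274136,
  2153602041882080, 2162328341404128, 2149220165704152, 2149206117177808, 2158000012417504,
  2149206117210576, 4401092987570136, 6652824081816024, 8917727715351008, 11154104435694040,
  6661534409677280, 2149293314548696, 8904605566523856, 2151952724121056, 2146901976799192,
  2160679023957984, 2153601991562720, 2149220159478232, 2149224454445528, 2157934782306784,
  4409734730233824, 6652884345439704, 11155169788582352, 6651020468377544]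

/-- Codes of `(0, 6)`-triples on seven labels. -/
def tripleCodes7 : List ℕ := [
  1125410974356056040, 5730375953684249040, 3424533777220654040, 1118655612761491928,
  6882664826794555856, 6882664869268842968, 4577499046608137184, 1123159172786337768,
  4577525499093998032, 3424604008527971288, 1118774116010186720, 4577538624463919584,
  4577503444387387360, 1118690707878865880, 5734843401290214376, 6884951879620240360,
  5734843475508512744, 1118725939359765960, 4584175482807601640, 1125410836917152744,
  5730424396006222816, 5730446528261665744, 1118677428242561504, 6884670473230885864,
  5730409093181926360, 1118690758252743120, 1123159174810028520, 6881842323304298976,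
  5730444123126225360, 4577499042313333728, 1118774114936432608, 4581923617763519464,
  4577525579706541016, 6882101985876569048, 5730374338324392408, 5739345769258904552,
  1118690758258870736, 1125410968983218152, 5730374338391206872, 6882392156511332832,
  1118761055014471112, 5730409521594919896, 6881925971679996888, 1118760919781759440,
  1118642174936148448, 6882383414906481616, 5739346318981458408, 5730411136703654864,
  5730375987574893016, 5730445360166880208, 1127768253324937192, 4577468255803894752,
  1127697752915261928, 1127768256680567784, 1125410834853849576, 6887203673796406248,
  5737094656338323944, 4577525588287576024, 1118730204350883296, 4577525499083512272,
  1121012670481951208, 5730444818718401496, 1118747928650143712, 6882770512442676680,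
  6882664938055583704, 5730408971900397528, 6886922273037928424, 6882106386131838944,
  4584175483894220776, 1118703747352422880, 1118769717283534816, 1118642218052971488,
  1125410905636751336, 6881820581857175512, 5739346313646107624, 4581923614542425064,
  5730444701680425432, 5730444157295352280, 4577525503753733072, 1127662495282358760,
  5730424395010549728, 4577538625594317280, 3431253978246900200, 1121012687511054824,
  1118690771229657560, 5730422745759897568, 3424612790578080224, 6888889709168356328,
  3431253914839575528, 6882123798291855328, 1127660335182002152, 2278330209123289064,
  1118771911670781920, 5730424396006190048, 1118774110641596384, 6881842323382216672,
  6882664863984134616, 4577529898229421536, 6882102022545524184, 5730387015910205920,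
  6889455474411727848, 4577538624512468960, 1125516270193501672, 1118761002532755928,
  1118703741983353824, 1125478315366668264, 5730419997158075360, 5730411235426790360,
  1120942284676146664, 6881890854955805656, 5730373788635671000, 1118633524905551328,
  6881842318959589344, 6890860994232707560, 1125478903710078952, 1118700993204627936,
  6882662116261719000, 1127659785470257128, 6882403068681546720, 5730444157360646104,
  6887203679429375976, 6887203673796439016, 6882101945481217480, 1118677426685275104,
  1118654788198115800, 1120940678391932392, 3424542358969280992, 1118725703342643160,
  1127660343828330984, 1118700997466040800, 4577525516353296856, 4577468260015172064,
  1118760988484196816, 6881820581773011416, 1118723481834974168, 6882403619444222432,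
  6882700117122837464, 6882662118425979864, 1118723073676536792, 5730419997158042592,
  6882664826804910544, 6881903891207777248, 1120942490448668136, 5732626104080295400,
  1125516261653571560, 4584175483894286312, 1118738376566384608, 3431253910628494312,
  1125443169615718888, 6889455473416120296, 4577468260015253984, 1118620433706567640,
  2271647464495106008, 1126533885569710056, 5730415604749050848, 6891142468118703080,
  1117795585308912096, 6882123792694471648, 1127660867757959144, 1123226554173615080,
  6882102014068569544, 1127662494319209448, 5739345769476733416, 1127662517025388520,
  1120940128602568168, 6889455473399343080, 1125408632609319400, 6882383414906514384,
  1126815360395683816, 1125478878108083688, 1121012686716282344, 3424497768682318320,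
  1123192443962485224, 1127662499610913256, 1118769851241604064, 6881820508830418904,
  4577525588287674328, 5730454087517100000, 4576574869521951216, 5730409073768786896,
  1126253492790193128, 1117233168249939936, 5730420002790848480, 1117282590035897304,
  1127659746553620968, 1118688834275634128, 1119814203026322920, 1127659794060191720,
  1118771911637227488, 6882462442352634848, 1118732879219059680, 1125408633588476904,
  5730446523683947976, 5739345765064947688, 6882664933710284760, 3424537960919356384,
  6881842323086470112, 1118761058499380680, 5730444671884080584, 1126534959160813544,
  1125410972204279784, 1123157382862924776, 1127768116897339880, 1125516282808096744,
  1120095695250023912, 1121012719604082664, 1118724014478093264, 1127660343828298216,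
  1120940678375155176, 6889455474411760616, 1125410831615486952, 1123264486525515752,
  5739345769537906664, 6882171586956650968, 3429037299448048616, 4577529898229409248,
  1117232644280694752, 5730410038265834448, 1126253518443096552, 1126253471198505448,
  3424579187844770784, 1118689963845708760, 1117795035620157920, 5730444153017456600,
  5730409517360802776, 1121012683365299688, 5730420002790979552, 1118624668951164384,
  5730409091030248408, 1118642192350623712, 1123194101809428968, 6888610980839910376,
  1118760951127300568, 6882101985876536280, 5730410032905513936, 5730382619404057056,
  5730411167668918232, 1127768082756023784, 6888892457914132968, 4577534231104088032,
  1117794996898359776, 3424544556458306528, 1118624694519903712, 1120940120180143592,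
  1118642419711260128, 6881820510961117144, 1117575097575991776, 6889455473432897512,
  1123159174799542760, 1127659785487034344, 1124317269725669864, 6882403619444287968,
  1126533894008911848, 6882102011918988744, 1127660335238396392, 6882102056771045336,
  1117564063939193304, 6882106274731189728, 1118723069375343576, 1123227636874503656,
  1117324473331706848, 4577490465125573592, 1117294169150319584, 1123264487291480040,
  4579671884518401000, 1118765384408868320, 5739345769470797800, 5730375953673796048,
  1117232643978947040, 3424612790578014688, 5730409092103924696, 4577455285050198488,
  1118055141893138904, 1127768254283892200, 6886922273037764584, 1127660309311809512,
  1127695493845112296, 1118624651764999648, 1124282184003316712, 6882662116278594520,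
  1118761058518447056, 1118633533494717408, 1118760956498822104, 1118687958025989080,
  1118725268406954968, 5730375982256663000, 5730424395027326944, 5730444681432683992,
  5739345769470454248, 1127659793781467624, 4584175482854090728, 1125410970140592616,
  1117577296548915680, 6881820577499301848, 1123264460759848936, 5730410037041294288,
  1120940128763782632, 6881901695372258272, 1117294172337957856, 4577490473708701656,
  1120940120012633576, 1126815884548860392, 4576082943059553232, 1126815334642657256,
  6882101914013625304, 5730409073768754128, 6888892523462707176, 6881820539045398992,
  1126253518426041320, 1118642418701912544, 1127659794076968936, 4584175483954776552,
  1120942486153717224, 1118054593244294104, 1117223916504738272, 4586427009102899688,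
  1118629227913721824, 1126815343366563816, 6888608783981242856, 3424614372216760800,
  6881890113070164952, 1123264482100468200, 1118723481835072472, 1125443169632496104,
  2271682558595520464, 1125443719338060264, 1126815893072046056, 6882123798029920736,
  1118725118276266960, 6882662664960928216, 1127662499828414952, 4576927503231075784,
  1118723055341464528, 1118769712862747104, 4584175348590488040, 1124317269708892648,
  5730444275402168792, 4584175482887293416, 6881820581777197528, 6882115147999405536,
  5730408968712738776, 1118722953473009624, 5730373788635327448, 1118674677906450912,
  2271612262859590096, 5730410032905481168, 1118769718223034848, 1118055142933326296,
  1123156355159780328, 5730409521594952664, 3424608466694952928, 1118674677939939808,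
  1126534945084369896, 6882662668115044824, 6882123798337731040, 5730411166575717336,
  6888610983004482024, 5730444707091077592, 6882664863967357400, 5730411172014217176,
  2280581251244406760, 1118725941773030856, 5732626104241497576, 6881890837690182608,
  1118642183821502432, 6881820510977894360, 4579707068706039272, 1127660343771969512,
  5730408971917174744, 1126533894109313000, 1123191378800196072, 1126533885519378408,
  1120940120113034728, 1127660335182034920, 5730387015893428704, 1118774111773809120,
  5730409521594887128, 1126815884548925928, 5730409500262427608, 3424581386859604960,
  1118747929611195872, 1118761007895173592, 1118700997482818016, 1117504841691884512,
  1120975862878840296, 1126253518409264104, 1127660859101161448, 1117781893153745888,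
  5734877354288298472, 1118633524871996896, 5730444671879886280, 1118624829871662560,
  1117282590035962840, 5739346319014783976, 6881890853882063832, 6882664869268990424,
  1127660859067639784, 5732626104247793128, 6882123806787692512, 5730445222637890000,
  1125481077131322856, 6881890853882031064, 1117514634636454368, 1123264461689480680,
  1118747933079512032, 6881820444405623768, 1117575093230692832, 5730419997157977056,
  1118723072602860504, 6882664826670803920, 4576892327583306712, 1118725959888259032,
  4576892249115880400, 5730446545286186968, 4577529829711160288, 1118738377578802144,
  6882102011921089992, 6886359252089596904, 1118738377578834912, 4577455271376868304,
  3424601692517001688, 5739346868720544232, 5730375982273440216, 1125444229398964712,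
  5730409488715765192, 5730444816570926040, 1118633623483959264, 5730449689479488480,
  1127660335175710696, 1127659759717230568, 6881820539034913232, 1126815343366203880,
  1124036344487767016, 4577538625552635872, 1124282184003349480, 1117778062010136032,
  1118054593244261336, 1125478336958131176, 1118774116012087776, 5730374333022432216,
  5739345765115279336, 6881842318808558048, 1125516282849778152, 5730375982290217432,
  3433503304593533928, 6881890113086909400, 4577538624528931296, 1118725148148329432,
  1124282186134023144, 1123194118989298152, 3423412061012517856, 1125516281767929832,
  1121012683314968040, 5739346319243360232, 1117504841691786208, 1125410970073745384,
  1118774110708705248, 1118774110708390368, 1119814778417985000, 1125410970134301160,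
  1118774111732127712, 5730444123136711120, 1127659759700453352, 1118724014478027728,
  1118624827592324576, 6882664863950580184, 1127660343771936744, 1127659794082904552,
  1125443169649273320, 3424612790569687520, 1120942554885498344, 1118765384408880608,
  1117795545647246304, 5730424394993772512, 5730408971933951960, 1123194353585146344,
  6881829197967866336, 1117795018573966304, 1122346945290529256, 1126252960231058408,
  1120940128770078184, 1125408701295282152, 5730457381432547808, 1117794996948756960,
  6881820440110983640, 5730374333022530520, 6881817691281549784, 1120975862874322920,
  1121785077534682088, 1126252943051189224, 1121785077534649320, 6882171586923096536,
  1117514070637079520, 2271679639196915672, 1125408083910502888, 1118761074467133400,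
  1118654788198083032, 1127659746570381800, 1118688323366906840, 4581923686606878696,
  6882662668115012056, 1118725255430040528, 1127660295218964968, 1118724018613906384,
  1118736727332497376, 1118733978730654688, 6882403618437295072, 1118723503167531992,
  1125410969067104232, 1127768081727838696, 1120942302006752744, 6881820577566410712,
  6888889709168290792, 4584175345436027880, 3423900312894891464, 1117294172337990624,
  1126815893072001000, 1118724014478126032, 1117294169150286816, 1120940678358377960,
  1125408701328836584, 6882101953876649432, 6882185370412706272, 6882383488988334544,
  1117514643176318944, 4576293393504758768, 6881820508830427096, 5730444672957822408,
  6882662664927341016, 6882735344302090712, 1118689963862829528, 1118701542960441824,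
  1117233168249600480, 3424006003180791240, 1118722950285350872, 1118736727332509664,
  1118700997499595232, 1118620296255302104, 5730445218284713416, 4577525503757927376,
  5730409092103990232, 5730417803503528928, 1118689963829275096, 1118725149241530328,
  6882497632223516640, 6882172390060610520, 6882102056766851032, 1124036344487701480,
  1118761057444705232, 1118774183785159136, 1118688834275699664, 5739345764980992488,
  1118725941794190288, 5729565063789827528, 3424577611566345184, 1118687765913315800,
  5730411172030994392, 3431251161855650792, 1118642218020022240, 5739345769554328040,
  1118629066986666464, 5737094719689115624, 1120942301956421096, 1118723055341398992,
  1118055141926693336, 5730375987574974936, 6882664869268924888, 5730410032901319632,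
  6882387767055279584, 1126815360412461032, 1117232635623651296, 6882102056793852376,
  1122348019032353256, 2271682493091043792, 6888892592131590120, 6881820510994671576,
  6882383414904384464, 1127768060387534312, 1118761002526464472, 1119814778451539432,
  3424617119905311200, 1124845685809998312, 1127659746704668648, 1118725951440901592,
  1120096219068507624, 6889452659121679336, 1123227135946714088, 1117233193902548960,
  1127659785325815784, 6882383417953938384, 6882664937988474840, 1118624804036851168,
  1124318329492138472, 5730409092103891928, 1118774252639101920, 1117295821605399520,
  1117577296548850144, 4577468260015041504, 1121012669490279912, 6888889709185035240,
  1117233159509256160, 1117778061976581600, 6881901695405747168, 1120940652756088296,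
  1125410970134235624, 1123264483036125672, 1127660318058494440, 1117795559706879968,
  4581958867416074728, 1121012660946478568, 1126252960063548392, 1126815334625880040,
  5737094651003152872, 6881820508830410712, 6881820440110967256, 1118774111773776352,
  1118774110691928032, 1118774111732094944, 6881820556225235416, 3424566512431557592,
  5730410037041327056, 5730409518373727192, 1127660318058527208, 1120942327770260968,
  1120942319180326376, 1118624694714672608, 1123229303315510760, 1118624686124738016,
  1123194127579232744, 1118629092756470240, 1124036344487734248, 5730444153067788248,
  1117564068183828952, 6882182620610161120, 1123194084505775080, 1123227614969785320,
  5730444701732788696, 5730408968712726488, 5737094651003169256, 5730408968712742872,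
  6882101985876503512, 1118629161413293536, 1127659768246351848, 1127659793915750376,
  1120940128702969320, 1120940643998639592, 1120940644032194024, 1127660859101194216,
  5730457930064615392, 3424532974139501528, 6882770534042818520, 1118629152829650400,
  1123229311911736808, 6882220549416048608, 6882662115204754392, 6889455474411695080,
  1125514088343811560, 1118722953506564056, 4577529898181187040, 4577534295186954720,
  5730444140316547544, 4584175483898415080, 4584175483898480616, 4584175414155847656,
  4577538625554733024, 4577538625554765792, 6882102056770979800, 4577503440176293856,
  1117795585308879328, 1126534993352747496, 1126815884548958696, 1125443719337994728,
  1125445918394510312, 6882662116278528984, 6882101919332329944, 2271682507133311448,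
  1125443719338027496, 1125443169648995304, 1123192443962583528, 1118725216999402456,
  1127659768313460712, 1118722950285338584, 1125408701261727720, 1118722953489786840,
  1118736731560335328, 1117233168266389984, 1117513569199582176, 1124845685810031080,
  1118689964869446104, 6890860994232740328, 6882662664893786584, 6882662664893819352,
  6891142468118670312, 5739346313646009320, 5730387015893085152, 3424581936615451616,
  5730422197060561888, 6882101914013690840, 5730424396006157280, 4576540405529471952,
  3423161457859390424, 1120940644159858152, 1123191370214357480, 1123191378804292072,
  1123192452542020072, 1120940120173848040, 1120940120173852136, 1118725938338154448,
  4577490452158695376, 6881820539173291984, 4577538624462137312, 5730408939030919120,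
  6881820470590126032, 1126533885418989544, 1126534993352714728, 1126815343383341032,
  1121785077534714856, 4577419294452083184, 1120975837110822888, 1123191378676411368,
  1123192443962550760, 1123191352906607592, 1124001260946975208, 1117795545613691872,
  6888889705913838056, 6888925852526373352, 6889453208844233192, 3424566512431524824,
  2280582350806333416, 2271625250851891680, 6888610982970616808, 4577468256810887648,
  4577494713876473312, 3429037093709016040, 5728896740792625624, 1120095678003033576,
  1117232618443782112, 1119814744091796968, 1126533868339509224, 1117497111170164192,
  1120095669480203752, 1120940102933165544, 1118728001032660448, 1125408632575764968,
  1118758683305400792, 1118771363005159904, 1118728001032672736, 1118765384360646112,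
  1125410970077874152, 1125410970077939688, 1118774111734192096, 1118774111734224864,
  1118703741966920160, 1123194353595533800, 1120942554889700840, 3429037362798840296,
  1125410831632574952, 1126534993352780264, 1127660859218029032, 1120940652739323368,
  1117491643274161112, 1118689964869478872, 6882182616264927712, 1127659746570398184,
  2278330205868574696, 2278330205935683560, 2271659881190008800, 1118701547188316640,
  1118730200055932384, 6881842318825351648, 1118690689533242320, 1118769717149297120,
  1118725804112145360, 6887203673796340712, 6882101983729052632, 1123159172652067304,
  2271695615248443360, 6881890853881998296, 6882383414906416080, 5730410032905415632,
  5730409500262362072, 6882101957025786840, 6881842323298019808, 5730375953539525584,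
  5730373977527118808, 6886359254234983400, 3433505508897450984, 3424581940843310048,
  5729002663392734160, 5729459166893501392, 4575977527651087824, 1117294168009763296,
  5730382619269786592, 6886359185651788776, 1117233168249923552, 1126534959160764392,
  4576342355813525984, 1118733978730589152, 3433503304593599464, 4576615036173431776,
  1127659794076613096, 1117795559706896352, 1126815343366547432, 1117564064962603480,
  1118723503167564760, 1118731784006527968, 1125410969066752488, 1117223916471167456,
  1117778062010131936, 5729565063791916488, 6882383484616357320, 5730454087517231072,
  2271691221890381792, 4576329311058154456, 4576892317835389392, 1125481085737200616,
  5730409497127970264, 4577455272073284048, 1118725703272917976, 5730444157293259224,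
  5730444707066173400, 6882735336792806360, 6887203679429212136, 4576927503231083976,
  5730446463690884056, 1118723073676602328, 4577490473708799960, 4577534231104075744,
  4584175482803759080, 1123159172786341864, 1118620364974770136, 6882664864990816728,
  6882662665967561176, 5730444701680294360, 1118738931638004704, 4581923686606890984,
  1118655549410798552, 6882383420268899280, 1118736181785095136, 6886922135605242856,
  1126533885284706792, 6882453857807913936, 1127662499627641320, 1126253518409542120,
  1118674677906385376, 5730446471198042584, 1118629193558083552, 5739346319306013160,
  1123264469345646568, 1118690518970330072, 1117786818106255840, 1118620399481038296,
  1127660859067607016, 1117795035586603488, 6881890837690149840, 1118731849236605920,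
  1118760862076773848, 1118642192417384928, 1118642174969620960, 1123156355159878632,
  4581958867405687272, 1118765388687058400, 1127768254401225704, 5734877354277911016,
  1126253518426319336, 1117795035603380704, 1120942284820588008, 5730444707068270552,
  1118760862078871000, 1118054593244359640, 1118642387697968608, 1117564063922416088,
  1127768254285989352, 6882664864990751192, 1123194101819861480, 5739346319243393000,
  1118723503167499224, 6891142468101827560, 3423653352203742192, 4577534295176534496,
  1118642218187532256, 1127660335238363624, 1117795545647311840, 1127768256546097128,
  6882383414900190160, 1127662508479490024, 1127662508496267240, 1120942559146911208,
  1118633490411596256, 5730375987642132952, 1118687958026087384, 1118738376599939040,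
  1118758134590068696, 1118738376583161824, 1118689963846052312, 1117293622582143968,
  1126253471131396584, 2271647442945001424, 1118690702510156760, 1118688323367005144,
  1118712748572953056, 1118629084166535648, 4577538625552668640, 1117232644113184736,
  1125516261647590888, 1118624763433531360, 1117795035586325472, 1118774111715207136,
  1118724018613971920, 1118055141893106136, 1118736250634071008, 6882383483623721424,
  1120940094404044264, 6881820444405934552, 1118624694553454048, 1125481077148100072,
  1118629161419584992, 1120942319035885032, 1118642217885461472, 6881842323086748128,
  5739346319249651688, 5739346319249684456, 4579707068710241768, 6882123798298114016,
  6882123798298146784, 4577468255804238304, 6882403068681481184, 6881901692184521696,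
  1127659746687891432, 3424604017108867544, 3429002184013236712, 1117794996898425312,
  1124318329491778536, 1118055141859584472, 6888889709168258024, 6882662116278496216,
  5737094102337547240, 5730387012705414112, 2278332473590065128, 5729811568742654936,
  5730445222637853136, 5730445217269180880, 4576615036173444064, 1118763185337390560,
  1120942293410522600, 1127662517065005544, 1120977503551829992, 1118624660354934240,
  1118633593752430048, 1123229277596046824, 1118747929609098720, 1126816421084785128,
  1124845136087444456, 1125410970056796136, 1127660343765645288, 1127660343765678056,
  1117232635523250144, 1123229303321802216, 1117575097559149024, 1127660335175743464,
  1120940678502819304, 1118769781355993568, 1125410970073679848, 1125410969033549800,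
  1126533885418977256, 1119814778468316648, 4577529898231518688, 5739345769259182568,
  5739345769393465320, 4584175345436338664, 5730444707068237784, 1118761066017670616,
  1122346928110660072, 1117564063922448856, 1127660309311842280, 1127659793781189608,
  1125443169615440872, 1120975304116266984, 1126534945067592680, 1117282590052674520,
  1124282186134121448, 1125478864092064744, 1118747929728525280, 1127659768296683496,
  1127659746637559784, 1118642169567422944, 3424612727436728800, 1117781893153680352,
  1117513543580511200, 1118629161050500064, 1118054592170519512, 1117564063888861656,
  1117575097575926240, 1117282590035930072, 6882402519932594656, 6882402519932660192,
  6882664864990783960, 5730375983296834008, 5730387565615671776, 5730387015926639584,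
  5730373784340720088, 5730422745759901664, 1118738377578769376, 1118723073676504024,
  5729529329596623824, 5730445217273240016, 1120940120106743272, 1120940128696677864,
  1123227662638003688, 1127659785486678504, 6882100339180221936, 1127660859228858344,
  1120940678519596520, 1123191370210261480, 1123192478311791080, 1123192478311823848,
  1120940128763786728, 1118761053988673488, 4577525567809214416, 5730444123264604112,
  4577525502304737744, 1117514634636388832, 3423371868775475696, 1127660867757991912,
  1127659768178928616, 1126253471131363816, 1117282593257122776, 1117575647281408480,
  1124282186150800360, 1117294172371512288, 1126534945084468200, 1118054593227484120,
  1126534395311778792, 1126534395311844328, 1117294172338023392, 1117280940785298392,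
  2271644458079856600, 1118689964869413336, 2271659881173231584, 6890860994165598696,
  2271622502072887776, 6890860994165631464, 6891142468118604776, 3424581386859572192,
  6882403068647926752, 6881890113070132184, 6881901695372192736, 4579706999974258152,
  4584175346459765224, 1118771361862216160, 1118652795262954456, 1118723055341366224,
  1118736728311393248, 1118733978730687456, 1118725823529413592, 1118655549410831320,
  5730375987574762456, 1118725942867932112, 6881890923675142616, 1118760988492454352,
  4577538766459642848, 4576082943059454928, 4576537554896398832, 1126815343382968808,
  1126815343383324648, 1124317269708876264, 1117514643176339424, 1119814778451535336,
  1117233168266700768, 1117513569484487136, 1126252968955165160, 1122346945290516968,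
  1117513560894552544, 1117220068615862752, 1126252960365230568, 1120095695250007528,
  1122346928110647784, 1117513543714683360, 1117220042846058976, 1126252943185361384,
  1117497119760098784, 1120095678070138344, 1117497119760102880, 1120095678070142440,
  1126533868389840872, 1127660318002132968, 1127660318002165736, 1125478878108067304,
  1120940128602564072, 1120975837110810600, 1120940652739306984, 1127659768313100776,
  1123227636874491368, 1120940652756084200, 1123191378810583528, 1123191370220648936,
  1123227628334569448, 1123191353040779752, 1120940103000274408, 1118629135649781216,
  1123229286141933032, 1127659746553604584, 1127662494242187752, 1118769781366413792,
  1118765384410977760, 1125410831615797736, 1125410900335306728, 5739345764997769704,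
  6881842318825335264, 6882102051435530712, 6888611118295370216, 1118738926355752928,
  1118703741983697376, 6882185365077535200, 5730373784340703704, 6888892454743189992,
  6888892523462698984, 5730422745759885280, 5730387561387829728, 3424608393622562272,
  3426785564099192296, 3424612790578076128, 1117220068615875040, 1127660343503743464,
  1120940128602580456, 1127660859234806248, 1120940652756100584, 1124282182879603176,
  1117575097525594592, 1117564063888894424, 1117575097525660128, 1126533846596446696,
  1117293619394472928, 1117575093264247264, 1117232047012047328, 1118055141859551704,
  1117610827392116704, 1118674677906107360, 1118700997465697248, 1118700997499251680,
  6882182620559829472, 1118689963862485976, 6882171586923129304, 6882182620559895008,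
  1118700994278026208, 1118722950285354968, 3424601143801669592, 6882121043915402208,
  1118700994278124512, 6881901142428707808, 2280581251311515624, 2271644454892197848,
  1118675227628661216, 1125408632609335784, 6882099165234555864, 1118701547188251104,
  1118701547188283872, 1118688314595044312, 1118736727332513760, 1118701542960458208,
  6882183166020741600, 6888608783981210088, 1118728001032676832, 3424614372216793568,
  1125408083910159336, 1125408632575781352, 3431251161855683560, 1127660295218621416,
  1118701543967091168, 1118723498933414872, 3424566508145011672, 1127660295218719720,
  3433503304593632232, 6882662664927373784, 6888608783947655656, 1118736178633173984,
  1125408083910257640, 3431251161855749096, 6890860994215963112, 6882402519982991840,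
  5739345764981008872, 1125410832639224296, 6882664863967046616, 5730375983296801240,
  1118703742990346720, 5730375983296866776, 5730387565615639008, 5730375982273096664,
  5730387565615704544, 5739345764997786088, 6882664863983823832, 6888892457914067432,
  5730375982289873880, 1118759198841792976, 1118766968370227680, 1118724014469737424,
  1118725818160704472, 2271682507139602904, 2271682579073980376, 5730410032897125328,
  5729529329730906576, 5729247888644958680, 4577490453180306888, 4577525568835012040,
  5729811027575729112, 2270168897738127344, 3423090393798765040, 1117232609753458656,
  2270731839001208816, 1126815343316232168, 1120095669413111272, 1126815884482078696,
  1117795559673358304, 1120095678003045864, 1117778036240344544, 1120096227758859752,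
  4576011919568529904, 1117233168199608288, 1117223916437629408, 1120095695182915048,
  1117233159659678176, 1119814744058258920, 1117497119709783520, 1119814744091813352,
  1124317269675338216, 1117497145479587296, 2270450372714838000, 1126533859649185768,
  1126534959127226344, 1117514634586417120, 1126815334793046504, 1117220034256136672,
  1119814744108590568, 1122346919520725480, 1117778036273898976, 1119814194335999464,
  1120940094242842088, 2271576272621680624, 1125478878074529256, 1120940652688991720,
  1120975828520888296, 1123227628284569064, 1126252371619736040, 1124001257658673640,
  1124001260879866344, 1117282588962155480, 1124001260879899112, 1124282732635384296,
  1117575642986506720, 1117561864915970520, 1117210716996528600, 1126252920335068136,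
  1124000709026606056, 1119849433066268648, 1124001257692228072, 1126252371670067688,
  1127659746503289320, 1118687765846223320, 1118700993204284384, 3429034545300302824,
  1125408632542226920, 2271644458096633816, 1118701542893349344, 6888608783914101224,
  2271611468452899288, 6888608783914133992, 2271693416244074464, 3424614920848828384,
  2271658231939356640, 3424610041798945248, 2278330137182611944, 2280581251160451560,
  2271680187912247768, 6881840119734987232, 2271692867612006880, 6881818241037396440,
  1118731848215358432, 2271649505639519712, 2280581251294738408, 2278330205902129128,
  2271693416277628896, 2271684689944237536, 2271686888967493088, 5739345764930677224,
  6881842318758242784, 3426785564032099816, 2271686889017824736, 2278332474684721128,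
  6881820440060651992, 5737094650969614824, 2278332404942153704, 2271695616341039072,
  5730373784273611224, 5730387561320737248, 3424608393572247008, 2273864059496547816,
  6888892454692874728, 1125410901425286120, 6882101982716128216, 6888611049575967720,
  2271660430962599904, 6882185365043997152, 1118703743057193952, 6882185365077551584,
  6888892523462715368, 3429037362805139944, 2273863789282993640, 2273863995055515112,
  2271651708957730272, 2270978850925488600, 1118760452770654680, 1118723055333075920,
  1118723069381635032, 2271612275836504536, 2276080677393184744, 2271682512502020568,
  2271691222829881824, 4577490331981245400, 5730446545286195160, 4577455203353783248,
  4584175482803415528, 4577490317932686288, 2276080679406389736, 4577455216330697688,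
  6882664826660318160, 6882383488988408272, 4577538624461826528, 1118699349621435360,
  4577463858073267168, 5730444277543360984, 4577534226674768352, 4581923683251276264,
  5730446528267957200, 5729534346185954272, 4577455271378965456, 5730411240800666584,
  5728897247984240080, 3423728720365245408, 5729253420831101920, 5729002663392603088,
  2270697470571334096]

end Tables

/-- Let `G` be a simple graph on `n ≤ 7` vertices with minimum degree at least `⌊n/2⌋`.
If `G` has a spanning 2T-subgraph, then `G` has property (*) unless `G` is the graph on
seven vertices obtained by identifying two disjoint copies of `K₄` at a single vertex. -/
theorem stmt14 [Fintype V] (G : SimpleGraph V)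
    (hn : Fintype.card V ≤ 7)
    (hdeg : ∀ v : V, Fintype.card V / 2 ≤ gdeg G v)
    (h2T : ∃ H : SimpleGraph V, H ≤ G ∧ IsTwoT H) :
    PropertyStar G ∨ (Fintype.card V = 7 ∧ IsTwoCliquesAtVertex G 4) := by
  obtain ⟨H, hHG, hH⟩ := h2T
  have hedge := hH.two_mul_card_le_ncard_edgeSet hHG
  have hn2 := hH.1
  rw [Nat.card_eq_fintype_card] at hedge hn2
  obtain ⟨n, hV⟩ : ∃ n, Fintype.card V = n := ⟨_, rfl⟩
  suffices h : ∃ C : List ℕ, C.all (IsTripleCode n) = true ∧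
      covers n (C.map fun c => bitSet (tripleEdges n c)) = true by
    obtain ⟨C, hC, hcov⟩ := h
    rw [hV] at hn hdeg hedge
    exact propertyStar_or_of_covers (hn.trans (by norm_num)) hV hdeg hedge hC hcov
  rw [hV] at hn hn2
  clear hV
  interval_cases n
  · exact ⟨[], by decide +kernel, by decide +kernel⟩
  · exact ⟨[], by decide +kernel, by decide +kernel⟩
  · exact ⟨tripleCodes4, by decide +kernel, by decide +kernel⟩
  · exact ⟨tripleCodes5, by decide +kernel, by decide +kernel⟩
  · exact ⟨tripleCodes6, by decide +kernel, by decide +kernel⟩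
  · exact ⟨tripleCodes7, by decide +kernel, by decide +kernel⟩
end

section
/- Every simple graph G on n ≥ 2 vertices with minimum degree at least ⌊n/2⌋ is ⌊n/2⌋-edge-connected: for every nonempty proper subset X of V(G), the number of edges with exactly one endpoint in X is at least ⌊n/2⌋. -/
open SimpleGraph

universe u

variable {V : Type u}

theorem edgeNbhd_compl (G : SimpleGraph V) (X : Set V) : edgeNbhd G Xᶜ = edgeNbhd G X := by
  ext e
  constructor
  · rintro ⟨u, v, rfl, h, hu, hv⟩
    exact ⟨v, u, Sym2.eq_swap, h.symm, not_not.mp hv, hu⟩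
  · rintro ⟨u, v, rfl, h, hu, hv⟩
    exact ⟨v, u, Sym2.eq_swap, h.symm, hv, not_not.mpr hu⟩

/-- A vertex of a set `X` with at least `X.ncard` neighbors has a neighbor outside `X`. -/
theorem exists_adj_notMem_of_ncard_le_gdeg [Finite V] (G : SimpleGraph V) {X : Set V} {v : V}
    (hv : v ∈ X) (h : X.ncard ≤ gdeg G v) : ∃ w, G.Adj v w ∧ w ∉ X := by
  by_contra! hX
  have hss : G.neighborSet v ⊂ X :=
    ⟨fun w hw => hX w hw, fun hle => G.irrefl (hle hv)⟩
  exact (Set.ncard_lt_ncard hss).not_ge h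

/-- If every vertex of `X` has a neighbor outside `X`, then `X` is left by at least as many
edges as the degree of any of its vertices. -/
theorem gdeg_le_ncard_edgeNbhd [Finite V] (G : SimpleGraph V) {X : Set V} {x : V} (hx : x ∈ X)
    (h : ∀ v ∈ X, ∃ w, G.Adj v w ∧ w ∉ X) : gdeg G x ≤ (edgeNbhd G X).ncard := by
  classical
  choose! f hadj hout using h
  refine Set.ncard_le_ncard_of_injOn (fun w => if w ∈ X then s(w, f w) else s(x, w)) ?_ ?_
    (Set.toFinite _)
  · intro w hw
    by_cases hwX : w ∈ X
    · simpa only [if_pos hwX] using ⟨w, f w, rfl, hadj w hwX, hwX, hout w hwX⟩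
    · simpa only [if_neg hwX] using ⟨x, w, rfl, hw, hx, hwX⟩
  · intro a ha b hb hab
    have hxa : x ≠ a := G.ne_of_adj ha
    have hxb : x ≠ b := G.ne_of_adj hb
    by_cases haX : a ∈ X <;> by_cases hbX : b ∈ X <;>
      simp only [haX, hbX, if_true, if_false, Sym2.eq_iff] at hab <;> grind

/-- Every simple graph on `n ≥ 2` vertices with minimum degree at least `⌊n/2⌋` is
`⌊n/2⌋`-edge-connected: every nonempty proper vertex set is left by at least `⌊n/2⌋`
edges. -/
theorem stmt16 [Fintype V] (G : SimpleGraph V)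
    (hn : 2 ≤ Fintype.card V)
    (hdeg : ∀ v : V, Fintype.card V / 2 ≤ gdeg G v) :
    ∀ X : Set V, X.Nonempty → X ≠ Set.univ →
      Fintype.card V / 2 ≤ (edgeNbhd G X).ncard := by
  intro X hne hX
  have key : ∀ Y : Set V, Y.Nonempty → Y.ncard ≤ Fintype.card V / 2 →
      Fintype.card V / 2 ≤ (edgeNbhd G Y).ncard := by
    rintro Y ⟨y, hy⟩ hcard
    exact (hdeg y).trans (gdeg_le_ncard_edgeNbhd G hy fun v hv =>
      exists_adj_notMem_of_ncard_le_gdeg G hv (hcard.trans (hdeg v)))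
  have hsum := Set.ncard_add_ncard_compl X
  rw [Nat.card_eq_fintype_card] at hsum
  by_cases hcard : X.ncard ≤ Fintype.card V / 2
  · exact key X hne hcard
  · rw [← edgeNbhd_compl]
    exact key Xᶜ (Set.nonempty_compl.mpr hX) (by omega)
end

section
/- Let G be a simple graph on n ≥ 4 vertices with minimum degree at least ⌊n/2⌋. If G has a cutvertex, then n is odd and G is the graph obtained by identifying two disjoint copies of the complete graph K_{⌈n/2⌉} at a single vertex. -/
open SimpleGraph

universe u

variable {V : Type u}

/-- The neighborhood of a vertex in a union `S` of components of `G - x` is contained in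
`S ∪ {x}`, so the degree is at most `S.ncard`. -/
lemma gdeg_le_ncard_of_closed [Finite V] {G : SimpleGraph V} {x v : V} {S : Set V}
    (hx : x ∉ S) (hS : ∀ u ∈ S, ∀ w, w ≠ x → G.Adj u w → w ∈ S) (hv : v ∈ S) :
    gdeg G v ≤ S.ncard ∧
      (gdeg G v = S.ncard → ∀ w ∈ insert x S, w ≠ v → G.Adj v w) := by
  have hsub : G.neighborSet v ⊆ insert x S \ {v} := by
    intro w hw
    have hw : G.Adj v w := hw
    refine ⟨?_, fun h => hw.ne h.symm⟩
    by_cases hwx : w = x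
    · exact Or.inl hwx
    · exact Or.inr (hS v hv w hwx hw)
  have hcard : (insert x S \ {v}).ncard = S.ncard := by
    rw [Set.ncard_sdiff_singleton_of_mem (Set.mem_insert_of_mem x hv),
      Set.ncard_insert_of_notMem hx, Nat.add_sub_cancel]
  refine ⟨hcard ▸ Set.ncard_le_ncard hsub, fun h w hw hwv => ?_⟩
  have heq := Set.eq_of_subset_of_ncard_le hsub (by rw [hcard]; exact h.ge)
  have : w ∈ G.neighborSet v := by rw [heq]; exact ⟨hw, hwv⟩
  exact this

/-- If `G - x` is disconnected, then its vertex set splits into two nonempty parts with no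
edges in between. -/
lemma exists_separation_of_one_lt_card [Finite V] {G : SimpleGraph V} {x : V}
    (h : 1 < Nat.card (G.induce ({x}ᶜ : Set V)).ConnectedComponent) :
    ∃ S : Set V, x ∉ S ∧ S.Nonempty ∧ (insert x S)ᶜ.Nonempty ∧
      ∀ u ∈ S, ∀ w, w ≠ x → G.Adj u w → w ∈ S := by
  obtain ⟨c, d, hcd⟩ := Finite.one_lt_card_iff_nontrivial.mp h
  induction c using ConnectedComponent.ind with | _ a
  induction d using ConnectedComponent.ind with | _ b
  refine ⟨{v | ∃ hv : v ≠ x, (G.induce ({x}ᶜ : Set V)).Reachable a ⟨v, hv⟩},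
    fun ⟨hv, _⟩ => hv rfl, ⟨a, a.2, Reachable.refl _⟩, ⟨b, ?_⟩, ?_⟩
  · rintro (hb | ⟨_, hb⟩)
    · exact b.2 hb
    · exact hcd (ConnectedComponent.sound hb)
  · rintro u ⟨hu, hau⟩ w hw huw
    refine ⟨hw, hau.trans (Adj.reachable ?_)⟩
    exact huw

/-- If a simple graph on `n ≥ 4` vertices with minimum degree at least `⌊n/2⌋` has a
cutvertex, then `n` is odd and `G` is obtained by identifying two disjoint copies of
`K_{⌈n/2⌉}` at a single vertex. -/
theorem stmt17 [Fintype V] (G : SimpleGraph V)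
    (hn : 4 ≤ Fintype.card V)
    (hdeg : ∀ v : V, Fintype.card V / 2 ≤ gdeg G v)
    (hcut : ∃ x : V, Nat.card G.ConnectedComponent <
        Nat.card (G.induce ({x}ᶜ : Set V)).ConnectedComponent) :
    Odd (Fintype.card V) ∧ IsTwoCliquesAtVertex G ((Fintype.card V + 1) / 2) := by
  obtain ⟨x, hx⟩ := hcut
  have : Nonempty V := ⟨x⟩
  have : Nonempty G.ConnectedComponent := ⟨G.connectedComponentMk x⟩
  have hpos : 0 < Nat.card G.ConnectedComponent := Nat.card_pos
  obtain ⟨S, hxS, ⟨a, ha⟩, ⟨b, hb⟩, hS⟩ :=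
    exists_separation_of_one_lt_card (lt_of_le_of_lt hpos hx)
  set T : Set V := (insert x S)ᶜ with hTdef
  have hxT : x ∉ T := fun h => h (Set.mem_insert x S)
  have hT : ∀ u ∈ T, ∀ w, w ≠ x → G.Adj u w → w ∈ T := by
    rintro u hu w hw huw (h | h)
    · exact hw h
    · exact hu (Or.inr (hS w h u (fun h => hu (Or.inl h)) huw.symm))
  have hST : (insert x S).ncard + T.ncard = Fintype.card V := by
    rw [← Nat.card_eq_fintype_card]
    exact Set.ncard_add_ncard_compl _
  have hSc := Set.ncard_insert_of_notMem hxS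
  have hTc := Set.ncard_insert_of_notMem hxT
  have hSle := (hdeg a).trans (gdeg_le_ncard_of_closed hxS hS ha).1
  have hTle := (hdeg b).trans (gdeg_le_ncard_of_closed hxT hT hb).1
  have adjS : ∀ u ∈ S, ∀ w ∈ insert x S, w ≠ u → G.Adj u w := fun u hu => by
    have h := gdeg_le_ncard_of_closed hxS hS hu
    have := hdeg u
    exact h.2 (by omega)
  have adjT : ∀ u ∈ T, ∀ w ∈ insert x T, w ≠ u → G.Adj u w := fun u hu => by
    have h := gdeg_le_ncard_of_closed hxT hT hu
    have := hdeg u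
    exact h.2 (by omega)
  have cover : ∀ u, u = x ∨ u ∈ S ∨ u ∈ T := fun u => by
    by_cases h : u ∈ insert x S
    · exact h.imp_right Or.inl
    · exact Or.inr (Or.inr h)
  refine ⟨by rw [Nat.odd_iff]; omega, insert x S, insert x T, x, ?_, ?_, by omega, by omega, ?_⟩
  · ext u
    simp only [hTdef, Set.mem_inter_iff, Set.mem_insert_iff, Set.mem_compl_iff,
      Set.mem_singleton_iff]
    tauto
  · ext u
    have := cover u
    simp only [Set.mem_union, Set.mem_insert_iff, Set.mem_univ, iff_true]
    tauto
  · intro u v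
    constructor
    · intro huv
      refine ⟨huv.ne, ?_⟩
      rcases cover u with rfl | hu | hu
      · rcases cover v with rfl | hv | hv
        · exact (huv.ne rfl).elim
        · exact Or.inl ⟨Or.inl rfl, Or.inr hv⟩
        · exact Or.inr ⟨Or.inl rfl, Or.inr hv⟩
      · exact Or.inl ⟨Or.inr hu, or_iff_not_imp_left.mpr fun h => hS u hu v h huv⟩
      · exact Or.inr ⟨Or.inr hu, or_iff_not_imp_left.mpr fun h => hT u hu v h huv⟩
    · rintro ⟨hne, ⟨rfl | hu, hv⟩ | ⟨rfl | hu, hv⟩⟩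
      · rcases hv with rfl | hv
        · exact (hne rfl).elim
        · exact (adjS v hv u (Or.inl rfl) hne).symm
      · exact adjS u hu v hv hne.symm
      · rcases hv with rfl | hv
        · exact (hne rfl).elim
        · exact (adjT v hv u (Or.inl rfl) hne).symm
      · exact adjT u hu v hv hne.symm
end

section
/- Suppose there exists a quartic Q that admits no (s,t)-triple for any pair of distinct transits s, t of Q. Then there exists a 4-regular graph G that admits no (s,t)-triple for any pair of distinct vertices s, t of G; moreover, if Q is 3-connected then G can be chosen to be 3-connected. -/
open SimpleGraph

universe u

variable {V : Type u}

/-- A graph is 3-connected if it has more than 3 vertices and stays connected after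
deleting any set of fewer than 3 vertices. -/
def ThreeConnected {α : Type u} (G : SimpleGraph α) : Prop :=
  3 < Nat.card α ∧ ∀ S : Set α, S.ncard < 3 → (G.induce Sᶜ).Connected

section TreeCounting

variable [Finite V]

lemma SimpleGraph.IsTree.ncard_edgeSet_add_one {T : SimpleGraph V} (hT : T.IsTree) :
    T.edgeSet.ncard + 1 = Nat.card V :=
  (isTree_iff_connected_and_card.1 hT).2

lemma SimpleGraph.IsAcyclic.ncard_edgeSet_add_one_le [Nonempty V] {T : SimpleGraph V}
    (hT : T.IsAcyclic) : T.edgeSet.ncard + 1 ≤ Nat.card V := by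
  obtain ⟨F, hTF, -, hF⟩ := connected_top.exists_isTree_le_of_le_of_isAcyclic le_top hT
  rw [← hF.ncard_edgeSet_add_one]
  exact Nat.add_le_add_right (Set.ncard_le_ncard (edgeSet_mono hTF) (Set.toFinite _)) 1

lemma SimpleGraph.IsAcyclic.connected_of_ncard_edgeSet [Nonempty V] {T : SimpleGraph V}
    (hT : T.IsAcyclic) (hcard : Nat.card V ≤ T.edgeSet.ncard + 1) : T.Connected := by
  obtain ⟨F, hTF, -, hF⟩ := connected_top.exists_isTree_le_of_le_of_isAcyclic le_top hT
  have hF' := hF.ncard_edgeSet_add_one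
  have : T.edgeSet = F.edgeSet :=
    Set.eq_of_subset_of_ncard_le (edgeSet_mono hTF) (by omega) (Set.toFinite _)
  rw [edgeSet_inj.1 this]
  exact hF.connected

/-- If every vertex of a tree other than `t` has a successor with respect to an asymmetric
relation, then this successor is unique, and `t` has none. -/
lemma SimpleGraph.IsTree.successor_unique {T : SimpleGraph V} (hT : T.IsTree)
    {lt : V → V → Prop} (hasymm : ∀ a b, lt a b → ¬ lt b a) {t : V}
    (hup : ∀ v, v ≠ t → ∃ w, T.Adj v w ∧ lt v w) {v w w' : V}
    (hw : T.Adj v w) (hvw : lt v w) (hw' : T.Adj v w') (hvw' : lt v w') : w = w' := by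
  choose! g hg using hup
  have hinj : Set.InjOn (fun u => s(u, g u)) ({t}ᶜ : Set V) := by
    intro a ha b hb hab
    rcases Sym2.eq_iff.1 hab with h | h
    · exact h.1
    · have h1 := (hg a ha).2
      have h2 := (hg b hb).2
      rw [h.2] at h1
      rw [← h.1] at h2
      exact absurd h2 (hasymm _ _ h1)
  have himage : (fun u => s(u, g u)) '' ({t}ᶜ : Set V) = T.edgeSet := by
    refine Set.eq_of_subset_of_ncard_le ?_ ?_ (Set.toFinite _)
    · rintro _ ⟨u, hu, rfl⟩
      exact (hg u hu).1
    · rw [hinj.ncard_image, Set.ncard_compl, Set.ncard_singleton]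
      have := hT.ncard_edgeSet_add_one
      omega
  have key : ∀ x, T.Adj v x → lt v x → x = g v := by
    intro x hx hlt
    have hmem : s(v, x) ∈ T.edgeSet := hx
    rw [← himage] at hmem
    obtain ⟨u, hu, huv⟩ := hmem
    rcases Sym2.eq_iff.1 huv with ⟨rfl, h⟩ | ⟨rfl, h⟩
    · exact h.symm
    · exact absurd (h ▸ (hg u hu).2) (hasymm _ _ hlt)
  rw [key w hw hvw, key w' hw' hvw']

/-- If every vertex of a tree has at most one successor with respect to a total asymmetric
relation, then every vertex other than the maximum has a successor. -/
lemma SimpleGraph.IsTree.exists_successor {T : SimpleGraph V} (hT : T.IsTree)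
    {lt : V → V → Prop} (hasymm : ∀ a b, lt a b → ¬ lt b a)
    (htotal : ∀ a b, a ≠ b → lt a b ∨ lt b a) {t : V} (ht : ∀ v, v ≠ t → lt v t)
    (huniq : ∀ v w w', T.Adj v w → lt v w → T.Adj v w' → lt v w' → w = w') :
    ∀ v, v ≠ t → ∃ w, T.Adj v w ∧ lt v w := by
  set U : Set V := {v | ∃ w, T.Adj v w ∧ lt v w} with hU
  have hex : ∀ v ∈ U, ∃ w, T.Adj v w ∧ lt v w := fun v hv => hv
  choose! g hg using hex
  have hsub : T.edgeSet ⊆ (fun u => s(u, g u)) '' U := by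
    have main : ∀ a b, T.Adj a b → lt a b → s(a, b) ∈ (fun u => s(u, g u)) '' U := by
      intro a b hab hlt
      have ha : a ∈ U := ⟨b, hab, hlt⟩
      refine ⟨a, ha, ?_⟩
      simp only
      rw [huniq a b (g a) hab hlt (hg a ha).1 (hg a ha).2]
    intro e
    induction e with
    | _ a b =>
      intro hab
      rw [mem_edgeSet] at hab
      rcases htotal a b hab.ne with h | h
      · exact main a b hab h
      · rw [Sym2.eq_swap]
        exact main b a hab.symm h
  have hcard : T.edgeSet.ncard ≤ U.ncard :=
    (Set.ncard_le_ncard hsub (Set.toFinite _)).trans (Set.ncard_image_le (Set.toFinite _))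
  have hUt : U ⊆ {t}ᶜ := by
    rintro v ⟨w, hvw, hlt⟩ rfl
    exact hasymm _ _ hlt (ht w hvw.ne')
  have hUeq : U = {t}ᶜ := by
    refine Set.eq_of_subset_of_ncard_le hUt ?_ (Set.toFinite _)
    rw [Set.ncard_compl, Set.ncard_singleton]
    have := hT.ncard_edgeSet_add_one
    omega
  intro v hv
  have : v ∈ U := hUeq ▸ hv
  exact this

/-- The successors of a tree in a part of the vertex set on which the tree stays connected:
they stay in the part, except at its maximum, whose successor leaves the part. -/
lemma SimpleGraph.IsTree.successor_comap {W : Type*} [Finite W] {T : SimpleGraph W}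
    (hT : T.IsTree) {lt : W → W → Prop} (hasymm : ∀ a b, lt a b → ¬ lt b a)
    (htotal : ∀ a b, a ≠ b → lt a b ∨ lt b a) {t : W}
    (hup : ∀ v, v ≠ t → ∃ w, T.Adj v w ∧ lt v w) {f : V → W} (hf : Function.Injective f)
    (hft : ∀ v, f v ≠ t) (hconn : (T.comap f).Connected) {m : V}
    (hm : ∀ v, v ≠ m → lt (f v) (f m)) :
    (∀ v, v ≠ m → ∃ w, (T.comap f).Adj v w ∧ lt (f v) (f w)) ∧
      ∃ w, T.Adj (f m) w ∧ w ∉ Set.range f := by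
  constructor
  · have hT' : (T.comap f).IsTree := ⟨hconn, hT.isAcyclic.of_comap ⟨f, hf⟩⟩
    refine hT'.exists_successor (lt := fun a b => lt (f a) (f b)) (fun a b => hasymm _ _)
      (fun a b hab => htotal _ _ (hf.ne hab)) hm ?_
    intro v w w' h1 h2 h3 h4
    exact hf (hT.successor_unique hasymm hup h1 h2 h3 h4)
  · obtain ⟨w, hw, hlt⟩ := hup (f m) (hft m)
    refine ⟨w, hw, ?_⟩
    rintro ⟨x, rfl⟩
    refine hasymm _ _ hlt (hm x ?_)
    rintro rfl
    exact hw.ne rfl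

end TreeCounting

section Degrees

lemma sum_gdeg_eq_two_mul_ncard_edgeSet [Fintype V] (G : SimpleGraph V) :
    ∑ v, gdeg G v = 2 * G.edgeSet.ncard := by
  classical
  have h := G.sum_degrees_eq_twice_card_edges
  have h1 : G.edgeSet.ncard = G.edgeFinset.card := by
    rw [← coe_edgeFinset, Set.ncard_coe_finset]
  rw [h1, ← h]
  refine Finset.sum_congr rfl fun v _ => ?_
  rw [gdeg, ← card_neighborSet_eq_degree, ← Nat.card_eq_fintype_card, Nat.card_coe_set_eq]

lemma IsTwoT.ncard_edgeSet [Finite V] {G : SimpleGraph V} (hG : IsTwoT G) :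
    G.edgeSet.ncard + 2 = 2 * Nat.card V := by
  obtain ⟨-, I, O, hI, hO, hdisj, rfl⟩ := hG
  have h1 := IsTree.ncard_edgeSet_add_one ⟨hI.2.1, hI.2.2⟩
  have h2 := IsTree.ncard_edgeSet_add_one ⟨hO.2.1, hO.2.2⟩
  rw [edgeSet_sup, Set.ncard_union_eq ?_ (Set.toFinite _) (Set.toFinite _)]
  · omega
  · rw [Set.disjoint_iff_inter_eq_empty, ← edgeSet_inf, hdisj, edgeSet_bot]

lemma IsQuartic.card_transits [Fintype V] {G : SimpleGraph V} (hG : IsQuartic G) :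
    Nat.card {v // IsTransit G v} = 4 := by
  classical
  have h1 := sum_gdeg_eq_two_mul_ncard_edgeSet G
  have h2 := hG.1.ncard_edgeSet
  have h3 : ∑ v, (gdeg G v + if IsTransit G v then 1 else 0) = ∑ _v : V, 4 := by
    refine Finset.sum_congr rfl fun v _ => ?_
    unfold IsTransit
    rcases hG.2 v with h | h <;> simp [h]
  rw [Finset.sum_add_distrib, Finset.sum_boole, Finset.sum_const, smul_eq_mul,
    Finset.card_univ] at h3
  rw [Nat.card_eq_fintype_card] at h2 ⊢
  rw [Fintype.card_subtype]
  simp only [Nat.cast_id] at h3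
  omega

end Degrees

section Gluing

variable (Q : SimpleGraph V) (ℓ : V → ZMod 5)

/-- Five copies of `Q`, any two of which are joined by the edge between the vertex of label
`j - i` in copy `i` and the vertex of label `i - j` in copy `j`. -/
def gluedGraph : SimpleGraph (ZMod 5 × V) where
  Adj p q := (p.1 = q.1 ∧ Q.Adj p.2 q.2) ∨
    (p.1 ≠ q.1 ∧ ℓ p.2 = q.1 - p.1 ∧ ℓ q.2 = p.1 - q.1)
  symm := ⟨by
    rintro p q (⟨h, h'⟩ | ⟨h, h', h''⟩)
    · exact Or.inl ⟨h.symm, h'.symm⟩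
    · exact Or.inr ⟨h.symm, h'', h'⟩⟩
  loopless := ⟨by
    rintro p (⟨-, h⟩ | ⟨h, -⟩)
    · exact h.ne rfl
    · exact h rfl⟩

/-- The labels `ℓ` restrict to a bijection from the transits of `Q` to the nonzero residues,
with inverse `τ`. -/
structure IsTransitLabelling (τ : ZMod 5 → V) : Prop where
  label_apply : ∀ d, d ≠ 0 → ℓ (τ d) = d
  apply_label : ∀ x, ℓ x ≠ 0 → τ (ℓ x) = x
  label_ne_zero_iff : ∀ x, ℓ x ≠ 0 ↔ IsTransit Q x

lemma IsQuartic.exists_transitLabelling [Fintype V] {Q : SimpleGraph V} (hQ : IsQuartic Q) :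
    ∃ (ℓ : V → ZMod 5) (τ : ZMod 5 → V), IsTransitLabelling Q ℓ τ := by
  classical
  have hcard : Nat.card {v // IsTransit Q v} = Nat.card {d : ZMod 5 // d ≠ 0} := by
    rw [hQ.card_transits, Nat.card_eq_fintype_card]
    decide
  let e : {v // IsTransit Q v} ≃ {d : ZMod 5 // d ≠ 0} := Classical.choice ((Finite.card_eq).1 hcard)
  refine ⟨fun x => if h : IsTransit Q x then (e ⟨x, h⟩ : ZMod 5) else 0,
    fun d => if h : d ≠ 0 then (e.symm ⟨d, h⟩ : V) else (e.symm ⟨1, by decide⟩ : V),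
    ⟨?_, ?_, ?_⟩⟩
  · intro d hd
    simp only [dif_pos hd, dif_pos (e.symm ⟨d, hd⟩).2, Subtype.coe_eta, Equiv.apply_symm_apply]
  · intro x hx
    by_cases h : IsTransit Q x
    · simp only [dif_pos h, dif_pos (e ⟨x, h⟩).2, Subtype.coe_eta, Equiv.symm_apply_apply]
    · simp [h] at hx
  · intro x
    by_cases h : IsTransit Q x
    · simp only [dif_pos h]
      exact iff_of_true (e ⟨x, h⟩).2 h
    · simp [h]

variable {Q ℓ}

lemma gluedGraph_adj_same {i : ZMod 5} {x y : V} :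
    (gluedGraph Q ℓ).Adj (i, x) (i, y) ↔ Q.Adj x y := by
  simp [gluedGraph]

lemma IsTransitLabelling.adj {τ : ZMod 5 → V} (hτ : IsTransitLabelling Q ℓ τ)
    {i j : ZMod 5} (hij : i ≠ j) :
    (gluedGraph Q ℓ).Adj (i, τ (j - i)) (j, τ (i - j)) :=
  Or.inr ⟨hij, hτ.label_apply _ (sub_ne_zero.2 hij.symm), hτ.label_apply _ (sub_ne_zero.2 hij)⟩

lemma IsTransitLabelling.isTransit_of_adj {τ : ZMod 5 → V} (hτ : IsTransitLabelling Q ℓ τ)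
    {i : ZMod 5} {x : V} {w : ZMod 5 × V} (h : (gluedGraph Q ℓ).Adj (i, x) w)
    (hw : w ∉ Set.range (Prod.mk i)) : IsTransit Q x := by
  obtain ⟨j, y⟩ := w
  rcases h with ⟨h, -⟩ | ⟨h, hx, -⟩
  · simp only at h
    subst h
    exact absurd ⟨y, rfl⟩ hw
  · refine (hτ.label_ne_zero_iff x).1 ?_
    rw [hx]
    exact sub_ne_zero.2 (Ne.symm h)

lemma IsTransitLabelling.gdeg_gluedGraph [Finite V] {τ : ZMod 5 → V}
    (hτ : IsTransitLabelling Q ℓ τ) (hdeg : ∀ v, gdeg Q v = 3 ∨ gdeg Q v = 4)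
    (v : ZMod 5 × V) : gdeg (gluedGraph Q ℓ) v = 4 := by
  obtain ⟨i, x⟩ := v
  have hinj : Function.Injective (Prod.mk i : V → ZMod 5 × V) := Prod.mk_right_injective i
  by_cases hx : ℓ x = 0
  · have hx' : ¬ IsTransit Q x := fun h => (hτ.label_ne_zero_iff x).2 h hx
    have : (gluedGraph Q ℓ).neighborSet (i, x) = Prod.mk i '' Q.neighborSet x := by
      ext ⟨j, y⟩
      constructor
      · rintro (⟨h, h'⟩ | ⟨h, h', -⟩)
        · exact ⟨y, h', Prod.ext h rfl⟩
        · simp only at h h'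
          rw [hx] at h'
          exact absurd (sub_eq_zero.1 h'.symm).symm h
      · rintro ⟨z, hz, hzy⟩
        rw [← hzy]
        exact gluedGraph_adj_same.2 hz
    rw [gdeg, this, Set.ncard_image_of_injective _ hinj]
    exact (hdeg x).resolve_left hx'
  · have hx' : IsTransit Q x := (hτ.label_ne_zero_iff x).1 hx
    have : (gluedGraph Q ℓ).neighborSet (i, x) =
        insert (i + ℓ x, τ (-ℓ x)) (Prod.mk i '' Q.neighborSet x) := by
      ext ⟨j, y⟩
      constructor
      · rintro (⟨h, h'⟩ | ⟨h, h', h''⟩)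
        · exact Or.inr ⟨y, h', Prod.ext h rfl⟩
        · simp only at h h' h''
          left
          have hy : ℓ y ≠ 0 := by rw [h'']; exact sub_ne_zero.2 h
          refine Prod.ext (by simp [h']) ?_
          simp only
          rw [h', neg_sub, ← h'', hτ.apply_label y hy]
      · rintro (h | ⟨z, hz, hzy⟩)
        · have := hτ.adj (i := i) (j := i + ℓ x) (by simpa using hx)
          simp only [add_sub_cancel_left, sub_add_cancel_left, hτ.apply_label x hx] at this
          rw [h]
          exact this
        · rw [← hzy]
          exact gluedGraph_adj_same.2 hz
    rw [gdeg, this, Set.ncard_insert_of_notMem _ (Set.toFinite _),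
      Set.ncard_image_of_injective _ hinj]
    · exact congrArg (· + 1) hx'
    · rintro ⟨z, -, hz⟩
      exact hx (by simpa using congrArg Prod.fst hz)

lemma IsTransitLabelling.threeConnected_gluedGraph [Finite V] {τ : ZMod 5 → V}
    (hτ : IsTransitLabelling Q ℓ τ) (hQ : ThreeConnected Q) :
    ThreeConnected (gluedGraph Q ℓ) := by
  classical
  refine ⟨?_, fun S hS => ?_⟩
  · have h := hQ.1
    rw [Nat.card_prod, Nat.card_zmod]
    omega
  have hcopy : ∀ i : ZMod 5, (Q.induce (Prod.mk i ⁻¹' S)ᶜ).Connected := by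
    intro i
    refine hQ.2 _ (lt_of_le_of_lt ?_ hS)
    rw [← Set.ncard_image_of_injective (Prod.mk i ⁻¹' S) (Prod.mk_right_injective i)]
    exact Set.ncard_le_ncard (Set.image_preimage_subset _ _) (Set.toFinite _)
  have hsame : ∀ (i : ZMod 5) (x y : V) (hx : (i, x) ∈ Sᶜ) (hy : (i, y) ∈ Sᶜ),
      ((gluedGraph Q ℓ).induce Sᶜ).Reachable ⟨(i, x), hx⟩ ⟨(i, y), hy⟩ := by
    intro i x y hx hy
    let φ : Q.induce (Prod.mk i ⁻¹' S)ᶜ →g (gluedGraph Q ℓ).induce Sᶜ :=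
      { toFun := fun z => ⟨(i, z.1), z.2⟩
        map_rel' := fun {a b} h => gluedGraph_adj_same.2 h }
    exact ((hcopy i).preconnected ⟨x, hx⟩ ⟨y, hy⟩).map φ
  obtain ⟨⟨x₀, hx₀⟩⟩ := (hcopy 0).nonempty
  have : Nonempty ↥(Sᶜ) := ⟨⟨(0, x₀), hx₀⟩⟩
  refine ⟨?_⟩
  rintro ⟨⟨i, x⟩, hx⟩ ⟨⟨j, y⟩, hy⟩
  by_cases hij : i = j
  · subst hij
    exact hsame i x y hx hy
  let block : ZMod 5 × V → ZMod 5 := fun s => if s.1 = i ∨ s.1 = j then s.1 + ℓ s.2 else s.1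
  obtain ⟨k, hk⟩ : ∃ k, k ∉ insert i (insert j (block '' S)) := by
    by_contra! hcon
    have huniv : insert i (insert j (block '' S)) = Set.univ := Set.eq_univ_of_forall hcon
    have h1 := Set.ncard_insert_le i (insert j (block '' S))
    have h2 := Set.ncard_insert_le j (block '' S)
    have h3 := Set.ncard_image_le (f := block) (Set.toFinite S)
    rw [huniv, Set.ncard_univ, Nat.card_zmod] at h1
    omega
  simp only [Set.mem_insert_iff, not_or] at hk
  obtain ⟨hki, hkj, hkS⟩ := hk
  have houter : ∀ c, c = i ∨ c = j → (c, τ (k - c)) ∈ Sᶜ := by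
    intro c hc hmem
    refine hkS ⟨_, hmem, ?_⟩
    have hkc : k ≠ c := by rcases hc with rfl | rfl <;> assumption
    simp only [block, if_pos hc, hτ.label_apply _ (sub_ne_zero.2 hkc), add_sub_cancel]
  have hinner : ∀ z, (k, z) ∈ Sᶜ := by
    intro z hmem
    refine hkS ⟨_, hmem, ?_⟩
    simp [block, hki, hkj]
  have hcross : ∀ c (hc : c = i ∨ c = j), ((gluedGraph Q ℓ).induce Sᶜ).Adj
      ⟨(c, τ (k - c)), houter c hc⟩ ⟨(k, τ (c - k)), hinner _⟩ := by
    intro c hc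
    have hkc : c ≠ k := by rcases hc with rfl | rfl <;> exact Ne.symm ‹_›
    exact hτ.adj hkc
  exact (hsame i _ _ hx (houter i (Or.inl rfl))).trans <|
    (hcross i (Or.inl rfl)).reachable.trans <|
    (hsame k _ _ (hinner _) (hinner _)).trans <|
    (hcross j (Or.inr rfl)).symm.reachable.trans (hsame j _ _ _ hy)

/-- Two edge-disjoint spanning trees of a 4-regular graph miss exactly two edges, so outside of
any two copies there is a copy that is contained in their union. -/
lemma exists_copy_le_sup [Fintype V] (hreg : ∀ v, gdeg (gluedGraph Q ℓ) v = 4)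
    {I O : SimpleGraph (ZMod 5 × V)} (hI : IsSpanningTree (gluedGraph Q ℓ) I)
    (hO : IsSpanningTree (gluedGraph Q ℓ) O) (hdisj : I ⊓ O = ⊥) (a b : ZMod 5) :
    ∃ i, i ≠ a ∧ i ≠ b ∧ Q ≤ (I ⊔ O).comap (Prod.mk i) := by
  classical
  by_contra! hcon
  have hbad : ∀ i, i ∈ ({a, b}ᶜ : Set (ZMod 5)) → ∃ e : Sym2 (ZMod 5 × V),
      e ∈ (gluedGraph Q ℓ).edgeSet \ (I ⊔ O).edgeSet ∧ ∀ p ∈ e, p.1 = i := by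
    intro i hi
    simp only [Set.mem_compl_iff, Set.mem_insert_iff, Set.mem_singleton_iff, not_or] at hi
    have h := hcon i hi.1 hi.2
    simp only [SimpleGraph.le_iff_adj, not_forall] at h
    obtain ⟨x, y, hxy, hn⟩ := h
    refine ⟨s((i, x), (i, y)), ⟨gluedGraph_adj_same.2 hxy, hn⟩, ?_⟩
    simp
  have : Nonempty (ZMod 5 × V) := hI.2.1.nonempty
  have : Nonempty V := this.map Prod.snd
  have : Nonempty (Sym2 (ZMod 5 × V)) := ‹Nonempty (ZMod 5 × V)›.map Sym2.diag
  choose! e he using hbad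
  have hinj : Set.InjOn e ({a, b}ᶜ : Set (ZMod 5)) := by
    intro i hi j hj hij
    have h1 := (he i hi).2 _ (Sym2.out_fst_mem (e i))
    have h2 := (he j hj).2 _ (hij ▸ Sym2.out_fst_mem (e i))
    rw [← h1, ← h2, hij]
  have hcard : ({a, b}ᶜ : Set (ZMod 5)).ncard ≤
      ((gluedGraph Q ℓ).edgeSet \ (I ⊔ O).edgeSet).ncard :=
    Set.ncard_le_ncard_of_injOn e (fun i hi => (he i hi).1) hinj (Set.toFinite _)
  have h1 : (I ⊔ O).edgeSet.ncard + 2 = 2 * Nat.card (ZMod 5 × V) := by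
    refine IsTwoT.ncard_edgeSet ⟨?_, I, O, ⟨le_sup_left, hI.2⟩, ⟨le_sup_right, hO.2⟩, hdisj, rfl⟩
    have := Nat.card_pos (α := V)
    rw [Nat.card_prod, Nat.card_zmod]
    omega
  have h2 : 2 * (gluedGraph Q ℓ).edgeSet.ncard = 4 * Nat.card (ZMod 5 × V) := by
    rw [← sum_gdeg_eq_two_mul_ncard_edgeSet, Finset.sum_congr rfl fun v _ => hreg v, Finset.sum_const,
      Finset.card_univ, Nat.card_eq_fintype_card, smul_eq_mul, mul_comm]
  rw [Set.ncard_sdiff (edgeSet_mono (sup_le hI.1 hO.1)) (Set.toFinite _), Set.ncard_compl,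
    Nat.card_zmod] at hcard
  have h3 := Set.ncard_insert_le a {b}
  rw [Set.ncard_singleton] at h3
  omega

/-- A triple of the glued graph restricts to a triple on any copy that avoids its ends and is
covered by its two trees. -/
lemma IsTransitLabelling.exists_triple_of_gluedGraph [Fintype V] {τ : ZMod 5 → V}
    (hτ : IsTransitLabelling Q ℓ τ) (hQ : IsQuartic Q) {s t : ZMod 5 × V}
    (h : HasSTTriple (gluedGraph Q ℓ) s t) :
    ∃ s' t', IsTransit Q s' ∧ IsTransit Q t' ∧ s' ≠ t' ∧ HasSTTriple Q s' t' := by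
  obtain ⟨r, I, O, hI, hO, hdisj, hup, hdown⟩ := h
  obtain ⟨i, his, hit, hcover⟩ :=
    exists_copy_le_sup (hτ.gdeg_gluedGraph hQ.2) hI hO hdisj s.1 t.1
  have hinj : Function.Injective (Prod.mk i : V → ZMod 5 × V) := Prod.mk_right_injective i
  have : Nontrivial V := Finite.one_lt_card_iff_nontrivial.1 hQ.1.1
  have hIQ : I.comap (Prod.mk i) ≤ Q := fun _ _ h => gluedGraph_adj_same.1 (hI.1 h)
  have hOQ : O.comap (Prod.mk i) ≤ Q := fun _ _ h => gluedGraph_adj_same.1 (hO.1 h)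
  have hIac : (I.comap (Prod.mk i)).IsAcyclic := hI.2.2.of_comap ⟨_, hinj⟩
  have hOac : (O.comap (Prod.mk i)).IsAcyclic := hO.2.2.of_comap ⟨_, hinj⟩
  have hdisj' : I.comap (Prod.mk i) ⊓ O.comap (Prod.mk i) = ⊥ := by
    rw [eq_bot_iff]
    intro x y hxy
    have : (I ⊓ O).Adj (i, x) (i, y) := hxy
    rw [hdisj] at this
    exact this.elim
  have hcount : Q.edgeSet.ncard ≤
      (I.comap (Prod.mk i)).edgeSet.ncard + (O.comap (Prod.mk i)).edgeSet.ncard := by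
    refine le_trans (Set.ncard_le_ncard ?_ (Set.toFinite _)) (Set.ncard_union_le _ _)
    rw [← edgeSet_sup]
    exact edgeSet_mono hcover
  have hQcard := hQ.1.ncard_edgeSet
  have hIcard := hIac.ncard_edgeSet_add_one_le
  have hOcard := hOac.ncard_edgeSet_add_one_le
  have hIconn := hIac.connected_of_ncard_edgeSet (by omega)
  have hOconn := hOac.connected_of_ncard_edgeSet (by omega)
  let r' : LinearOrder V := @LinearOrder.lift' V (ZMod 5 × V) r (Prod.mk i) hinj
  obtain ⟨m, hm⟩ : ∃ m, ∀ v, v ≠ m → r'.lt v m := by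
    obtain ⟨m, hm⟩ := Finite.exists_max (id : V → V)
    exact ⟨m, fun v hv => lt_of_le_of_ne (hm v) hv⟩
  obtain ⟨l, hl⟩ : ∃ l, ∀ v, v ≠ l → r'.lt l v := by
    obtain ⟨l, hl⟩ := Finite.exists_min (id : V → V)
    exact ⟨l, fun v hv => lt_of_le_of_ne (hl v) hv.symm⟩
  have hasymm : ∀ a b, r.lt a b → ¬ r.lt b a := fun a b => @lt_asymm _ r.toPreorder a b
  have htotal : ∀ a b, a ≠ b → r.lt a b ∨ r.lt b a := fun a b => @lt_or_gt_of_ne _ r a b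
  obtain ⟨hIup, wt, hwt, hwt'⟩ := IsTree.successor_comap (lt := r.lt) ⟨hI.2.1, hI.2.2⟩
    hasymm htotal hup hinj (fun v hv => hit (congrArg Prod.fst hv)) hIconn hm
  obtain ⟨hOdown, ws, hws, hws'⟩ := IsTree.successor_comap (lt := fun a b => r.lt b a)
    ⟨hO.2.1, hO.2.2⟩ (fun a b => hasymm b a) (fun a b hab => htotal b a hab.symm) hdown hinj
    (fun v hv => his (congrArg Prod.fst hv)) hOconn hl
  refine ⟨l, m, hτ.isTransit_of_adj (hO.1 hws) hws', hτ.isTransit_of_adj (hI.1 hwt) hwt', ?_,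
    r', _, _, ⟨hIQ, hIconn, hIac⟩, ⟨hOQ, hOconn, hOac⟩, hdisj', hIup, hOdown⟩
  rintro rfl
  obtain ⟨x, hx⟩ := exists_ne l
  exact hasymm _ _ (hm x hx) (hl x hx)

end Gluing

/-- If some quartic `Q` admits no `(s,t)`-triple for any pair of distinct transits, then
there is a 4-regular graph admitting no `(s,t)`-triple for any pair of distinct
vertices; moreover, if `Q` is 3-connected then such a graph can be chosen 3-connected. -/
theorem stmt19 {α : Type} [Fintype α] (Q : SimpleGraph α) (hQ : IsQuartic Q)
    (hno : ∀ s t : α, IsTransit Q s → IsTransit Q t → s ≠ t → ¬ HasSTTriple Q s t) :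
    (∃ (β : Type) (_ : Fintype β) (G : SimpleGraph β),
        (∀ v : β, gdeg G v = 4) ∧ ∀ s t : β, s ≠ t → ¬ HasSTTriple G s t) ∧
    (ThreeConnected Q → ∃ (β : Type) (_ : Fintype β) (G : SimpleGraph β),
        (∀ v : β, gdeg G v = 4) ∧ ThreeConnected G ∧
        ∀ s t : β, s ≠ t → ¬ HasSTTriple G s t) := by
  obtain ⟨ℓ, τ, hτ⟩ := hQ.exists_transitLabelling
  have hreg := hτ.gdeg_gluedGraph hQ.2
  have hnone : ∀ s t : ZMod 5 × α, s ≠ t → ¬ HasSTTriple (gluedGraph Q ℓ) s t := by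
    intro s t _ h
    obtain ⟨s', t', hs, ht, hne, h'⟩ := hτ.exists_triple_of_gluedGraph hQ h
    exact hno s' t' hs ht hne h'
  exact ⟨⟨ZMod 5 × α, inferInstance, gluedGraph Q ℓ, hreg, hnone⟩, fun h3 =>
    ⟨ZMod 5 × α, inferInstance, gluedGraph Q ℓ, hreg, hτ.threeConnected_gluedGraph h3, hnone⟩⟩
end
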